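/- arXiv:1903.09534 — 2 statements merged into one kernel-verified Lean document; each statement's English description precedes it below -/
import Mathlib

section
/- Suppose assumption (H1) holds, the feasible set {(x,y) ∈ A ∩ B : J(x,y) ≥ 0} of problem (MPEC) is nonempty, and (J_k) is a sequence of polynomials with J_k(z) ≤ J(z) for all z ∈ Ω and J_k → J in L¹(Ω,μ). Then for every ε > 0 the limit lim_{k→∞} v_ε^k exists and satisfies val(P_ε) ≤ lim_{k→∞} v_ε^k ≤ lim_{δ → ε⁻} val(P_δ). Furthermore, the equality val(P_ε) = lim_{k→∞} v_ε^k holds for all ε ∈ (0,∞) except finitely many points. -/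
open MvPolynomial Set Filter MeasureTheory

/-- An order automorphism of the line which moves one point of an interval to another one and
fixes everything outside the interval. -/
lemma exists_orderIso_moving {lo c d hi : ℝ} (hc : c ∈ Ioo lo hi) (hd : d ∈ Ioo lo hi) :
    ∃ e : ℝ ≃o ℝ, e c = d ∧ ∀ t, t ∉ Ioo lo hi → e t = t := by
  wlog hcd : c ≤ d generalizing c d
  · obtain ⟨e, he, hfix⟩ := this hd hc (le_of_not_ge hcd)
    refine ⟨e.symm, by rw [← he, e.symm_apply_apply], fun t ht => ?_⟩
    rw [OrderIso.symm_apply_eq, hfix t ht]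
  obtain ⟨hc1, hc2⟩ := hc
  obtain ⟨hd1, hd2⟩ := hd
  have hk : 1 ≤ (d - lo) / (c - lo) := by rw [one_le_div (by linarith)]; linarith
  have hl : (hi - d) / (hi - c) ≤ 1 := by rw [div_le_one (by linarith)]; linarith
  have hl0 : 0 < (hi - d) / (hi - c) := div_pos (by linarith) (by linarith)
  have hkc : (d - lo) / (c - lo) * (c - lo) = d - lo := div_mul_cancel₀ _ (by linarith)
  have hlc : (hi - d) / (hi - c) * (hi - c) = hi - d := div_mul_cancel₀ _ (by linarith)
  set k := (d - lo) / (c - lo)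
  set l := (hi - d) / (hi - c)
  let F : ℝ → ℝ := fun t => max t (min (lo + k * (t - lo)) (hi - l * (hi - t)))
  have hmono : StrictMono F :=
    fun a b hab => max_lt_max hab (min_lt_min (by nlinarith) (by nlinarith))
  have hcont : Continuous F := by fun_prop
  have hfix : ∀ t, t ∉ Ioo lo hi → F t = t := by
    intro t ht
    rw [mem_Ioo, not_and_or, not_lt, not_lt] at ht
    refine max_eq_left ?_
    rcases ht with ht | ht
    · exact (min_le_left _ _).trans (by nlinarith)
    · exact (min_le_right _ _).trans (by nlinarith)
  have hsurj : Function.Surjective F := by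
    refine hcont.surjective (tendsto_atTop_mono (fun t => le_max_left _ _) tendsto_id) ?_
    refine tendsto_id.congr' ?_
    filter_upwards [eventually_le_atBot lo] with t ht
    exact (hfix t fun h => absurd h.1 (not_lt.2 ht)).symm
  refine ⟨hmono.orderIsoOfSurjective F hsurj, ?_, fun t ht => hfix t ht⟩
  change max c (min (lo + k * (c - lo)) (hi - l * (hi - c))) = d
  rw [hkc, hlc]
  simp [hcd]

lemma sign_eval_eq_of_forall_ne_zero {p : Polynomial ℝ} {a b : ℝ}
    (h : ∀ t ∈ uIcc a b, p.eval t ≠ 0) :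
    SignType.sign (p.eval a) = SignType.sign (p.eval b) := by
  have hIVT := intermediate_value_uIcc (f := fun t => p.eval t) (a := a) (b := b)
    p.continuous.continuousOn
  have h0 : (0 : ℝ) ∉ uIcc (p.eval a) (p.eval b) := fun h0 => by
    obtain ⟨t, ht, h0⟩ := hIVT h0
    exact h t ht h0
  have ha := h a left_mem_uIcc
  have hb := h b right_mem_uIcc
  rw [mem_uIcc] at h0
  push Not at h0
  rcases lt_or_gt_of_ne ha with ha | ha <;> rcases lt_or_gt_of_ne hb with hb | hb
  · rw [sign_neg ha, sign_neg hb]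
  · exact absurd (h0.1 ha.le) (by linarith)
  · exact absurd (h0.2 hb.le) (by linarith)
  · rw [sign_pos ha, sign_pos hb]

/-- Changing an order automorphism away from the roots of `p` keeps the sign of `q` matched. -/
lemma sign_eval_eq_of_eqOn_roots {p q : Polynomial ℝ} {θ θ' : ℝ ≃o ℝ} {Z : Set ℝ}
    (hθ : ∀ t, SignType.sign (p.eval t) = SignType.sign (q.eval (θ t)))
    (hZ : p ≠ 0 → ∀ t, p.eval t = 0 → t ∈ Z) (heq : ∀ t ∈ Z, θ' t = θ t) (t : ℝ) :
    SignType.sign (p.eval t) = SignType.sign (q.eval (θ' t)) := by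
  rcases eq_or_ne p 0 with rfl | hp
  · simpa using hθ (θ.symm (θ' t))
  by_cases h : p.eval t = 0
  · rw [heq t (hZ hp t h), hθ]
  have key : SignType.sign (p.eval t) = SignType.sign (p.eval (θ.symm (θ' t))) := by
    refine sign_eval_eq_of_forall_ne_zero fun u hu hu0 => ?_
    have huZ := heq u (hZ hp u hu0)
    have hut : u ≠ t := fun hut => h (hut ▸ hu0)
    rw [mem_uIcc, OrderIso.le_symm_apply, OrderIso.symm_apply_le, ← huZ, θ'.le_iff_le,
      θ'.le_iff_le] at hu
    rcases hu with hu | hu <;> exact hut (le_antisymm (by tauto) (by tauto))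
  rw [key, hθ, θ.apply_symm_apply]

lemma eventually_eval_pos {p : Polynomial ℝ} (hp : 0 < p.leadingCoeff) :
    ∀ᶠ t in atTop, 0 < p.eval t := by
  by_cases hdeg : 0 < p.degree
  · exact (p.tendsto_atTop_of_leadingCoeff_nonneg hdeg hp.le).eventually_gt_atTop 0
  · rw [Polynomial.eq_C_of_degree_le_zero (not_lt.1 hdeg)] at hp ⊢
    exact Eventually.of_forall fun t => by simpa using hp

lemma eventually_sign_eval_eq_sign_derivative {p : Polynomial ℝ} (hp : 0 < p.natDegree) :
    ∀ᶠ t in atTop, SignType.sign (p.eval t) = SignType.sign (p.derivative.eval t) := by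
  wlog hlead : 0 < p.leadingCoeff generalizing p
  · have hne : p.leadingCoeff ≠ 0 := fun h => by
      rw [Polynomial.leadingCoeff_eq_zero] at h
      simp [h] at hp
    have := this (p := -p) (by simpa) (by
      rw [Polynomial.leadingCoeff_neg]
      exact neg_pos.2 (lt_of_le_of_ne (not_lt.1 hlead) hne))
    simpa [Left.sign_neg] using this
  have hder : 0 < p.derivative.leadingCoeff := by
    rw [Polynomial.leadingCoeff, Polynomial.natDegree_derivative, Polynomial.coeff_derivative,
      Nat.sub_add_cancel hp]
    exact mul_pos hlead (by positivity)
  filter_upwards [eventually_eval_pos hlead, eventually_eval_pos hder] with t h1 h2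
  rw [sign_pos h1, sign_pos h2]

lemma exists_forall_ge_sign_eval_eq {p : Polynomial ℝ} (hp : 0 < p.natDegree) :
    ∃ N, ∀ t, N ≤ t → SignType.sign (p.eval t) = SignType.sign (p.derivative.eval t) :=
  eventually_atTop.1 (eventually_sign_eval_eq_sign_derivative hp)

lemma exists_forall_le_sign_eval_eq {p : Polynomial ℝ} (hp : 0 < p.natDegree) :
    ∃ N, ∀ t ≤ N, SignType.sign (p.eval t) = -SignType.sign (p.derivative.eval t) := by
  obtain ⟨N, hN⟩ := exists_forall_ge_sign_eval_eq (p := p.comp (-Polynomial.X))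
    (by simpa [Polynomial.natDegree_comp] using hp)
  refine ⟨-N, fun t ht => ?_⟩
  simpa [Polynomial.derivative_comp, Left.sign_neg] using hN (-t) (by linarith)

lemma exists_adjacent {Z : Finset ℝ} {t : ℝ} (ht : t ∉ Z) (hlo : ∃ z ∈ Z, z < t)
    (hhi : ∃ z ∈ Z, t < z) :
    ∃ z₁ ∈ Z, ∃ z₂ ∈ Z, t ∈ Ioo z₁ z₂ ∧ ∀ u ∈ Ioo z₁ z₂, u ∉ Z := by
  obtain ⟨z₁, h₁, hmax⟩ := (Z.filter (· < t)).exists_max_image id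
    (by obtain ⟨z, hz, hzt⟩ := hlo; exact ⟨z, by simp [hz, hzt]⟩)
  obtain ⟨z₂, h₂, hmin⟩ := (Z.filter (t < ·)).exists_min_image id
    (by obtain ⟨z, hz, hzt⟩ := hhi; exact ⟨z, by simp [hz, hzt]⟩)
  simp only [Finset.mem_filter, id] at h₁ h₂ hmax hmin
  refine ⟨z₁, h₁.1, z₂, h₂.1, ⟨h₁.2, h₂.2⟩, fun u hu huZ => ?_⟩
  rcases lt_trichotomy u t with h | h | h
  · exact absurd hu.1 (not_lt.2 (hmax u ⟨huZ, h⟩))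
  · exact ht (h ▸ huZ)
  · exact absurd hu.2 (not_lt.2 (hmin u ⟨huZ, h⟩))

/-- If the signs of the derivatives of two polynomials are matched by an order automorphism, then
on an interval without critical points both are strictly increasing or both are strictly
decreasing. -/
lemma strictMonoOn_and_or_strictAntiOn_and {a b : Polynomial ℝ} {θ : ℝ ≃o ℝ} {z₁ z₂ : ℝ}
    (hder : ∀ t, SignType.sign (a.derivative.eval t) = SignType.sign (b.derivative.eval (θ t)))
    (hne : ∀ u ∈ Ioo z₁ z₂, a.derivative.eval u ≠ 0) :
    (StrictMonoOn (fun t => a.eval t) (Icc z₁ z₂) ∧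
      StrictMonoOn (fun t => b.eval t) (Icc (θ z₁) (θ z₂))) ∨
    (StrictAntiOn (fun t => a.eval t) (Icc z₁ z₂) ∧
      StrictAntiOn (fun t => b.eval t) (Icc (θ z₁) (θ z₂))) := by
  have himage : ∀ u ∈ Ioo (θ z₁) (θ z₂), θ.symm u ∈ Ioo z₁ z₂ := fun u hu =>
    ⟨θ.lt_symm_apply.2 hu.1, θ.symm_apply_lt.2 hu.2⟩
  have hconst : ∀ u ∈ Ioo z₁ z₂, ∀ w ∈ Ioo z₁ z₂,
      SignType.sign (a.derivative.eval u) = SignType.sign (a.derivative.eval w) :=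
    fun u hu w hw => sign_eval_eq_of_forall_ne_zero fun t ht =>
      hne t (ordConnected_Ioo.uIcc_subset hu hw ht)
  have hb : ∀ u, SignType.sign (b.derivative.eval u) =
      SignType.sign (a.derivative.eval (θ.symm u)) := fun u => by rw [hder, θ.apply_symm_apply]
  by_cases hpos : ∀ u ∈ Ioo z₁ z₂, 0 < a.derivative.eval u
  · left
    constructor
    · refine strictMonoOn_of_deriv_pos (convex_Icc _ _) a.continuous.continuousOn fun u hu => ?_
      rw [interior_Icc] at hu
      rw [Polynomial.deriv]
      exact hpos u hu
    · refine strictMonoOn_of_deriv_pos (convex_Icc _ _) b.continuous.continuousOn fun u hu => ?_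
      rw [interior_Icc] at hu
      rw [Polynomial.deriv, ← sign_eq_one_iff, hb, sign_eq_one_iff]
      exact hpos _ (himage u hu)
  · right
    push Not at hpos
    obtain ⟨w, hw, hw0⟩ := hpos
    have hw0 := lt_of_le_of_ne hw0 (hne w hw)
    have hneg : ∀ u ∈ Ioo z₁ z₂, a.derivative.eval u < 0 := fun u hu => by
      rw [← sign_eq_neg_one_iff, hconst u hu w hw, sign_eq_neg_one_iff]
      exact hw0
    constructor
    · refine strictAntiOn_of_deriv_neg (convex_Icc _ _) a.continuous.continuousOn fun u hu => ?_
      rw [interior_Icc] at hu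
      rw [Polynomial.deriv]
      exact hneg u hu
    · refine strictAntiOn_of_deriv_neg (convex_Icc _ _) b.continuous.continuousOn fun u hu => ?_
      rw [interior_Icc] at hu
      rw [Polynomial.deriv, ← sign_eq_neg_one_iff, hb, sign_eq_neg_one_iff]
      exact hneg _ (himage u hu)

lemma sign_eq_neg_iff_of_sign_eq {x y : ℝ} (h : SignType.sign x = SignType.sign y) :
    (x < 0 ↔ y < 0) ∧ (0 < x ↔ 0 < y) ∧ (x = 0 ↔ y = 0) :=
  ⟨by rw [← sign_eq_neg_one_iff, h, sign_eq_neg_one_iff],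
    by rw [← sign_eq_one_iff, h, sign_eq_one_iff], by rw [← sign_eq_zero_iff, h, sign_eq_zero_iff]⟩

/-- An order automorphism can be changed away from `Z` so as to send given roots of `a` to roots
of `b`. -/
lemma exists_orderIso_map_roots {a b : Polynomial ℝ} {θ : ℝ ≃o ℝ} {Z : Finset ℝ}
    (hder : ∀ t, SignType.sign (a.derivative.eval t) = SignType.sign (b.derivative.eval (θ t)))
    (hZ : ∀ t, a.derivative.eval t = 0 → t ∈ Z)
    (hsign : ∀ z ∈ Z, SignType.sign (a.eval z) = SignType.sign (b.eval (θ z)))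
    (hlo : ∀ r, a.eval r = 0 → ∃ z ∈ Z, z < r) (hhi : ∀ r, a.eval r = 0 → ∃ z ∈ Z, r < z)
    (S : Finset ℝ) (hS : ∀ r ∈ S, a.eval r = 0) :
    ∃ θ' : ℝ ≃o ℝ, (∀ z ∈ Z, θ' z = θ z) ∧ ∀ r ∈ S, b.eval (θ' r) = 0 := by
  induction S using Finset.induction_on with
  | empty => exact ⟨θ, fun _ _ => rfl, by simp⟩
  | insert r S hrS ih =>
    obtain ⟨θ', hθ', hroots⟩ := ih fun r hr => hS r (Finset.mem_insert_of_mem hr)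
    by_cases hbr : b.eval (θ' r) = 0
    · exact ⟨θ', hθ', by simpa [hbr] using hroots⟩
    have har : a.eval r = 0 := hS r (Finset.mem_insert_self _ _)
    have hrZ : r ∉ Z := fun hrZ => hbr <| by
      rw [hθ' r hrZ, ← sign_eq_zero_iff, ← hsign r hrZ, har, sign_zero]
    obtain ⟨z₁, hz₁, z₂, hz₂, hr, hfree⟩ := exists_adjacent hrZ (hlo r har) (hhi r har)
    have hz : z₁ < z₂ := hr.1.trans hr.2
    obtain ⟨hn1, hp1, -⟩ := sign_eq_neg_iff_of_sign_eq (hsign z₁ hz₁)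
    obtain ⟨hn2, hp2, -⟩ := sign_eq_neg_iff_of_sign_eq (hsign z₂ hz₂)
    have hmono := strictMonoOn_and_or_strictAntiOn_and hder (z₁ := z₁) (z₂ := z₂)
      fun u hu h0 => hfree u hu (hZ u h0)
    have hinj : InjOn (fun t => a.eval t) (Icc z₁ z₂) := by
      rcases hmono with h | h
      exacts [h.1.injOn, h.1.injOn]
    have hs : ∃ s ∈ Ioo (θ z₁) (θ z₂), b.eval s = 0 := by
      have hθz : θ z₁ ≤ θ z₂ := θ.monotone hz.le
      have hm1 := left_mem_Icc.2 hz.le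
      have hm2 := right_mem_Icc.2 hz.le
      have hmr := Ioo_subset_Icc_self hr
      rcases hmono with ⟨h, -⟩ | ⟨h, -⟩
      · have h1 := h hm1 hmr hr.1
        have h2 := h hmr hm2 hr.2
        simp only [har] at h1 h2
        exact intermediate_value_Ioo hθz b.continuous.continuousOn ⟨hn1.1 h1, hp2.1 h2⟩
      · have h1 := h hm1 hmr hr.1
        have h2 := h hmr hm2 hr.2
        simp only [har] at h1 h2
        exact intermediate_value_Ioo' hθz b.continuous.continuousOn ⟨hn2.1 h2, hp1.1 h1⟩
    obtain ⟨s, hs, hbs⟩ := hs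
    have hIoo : ∀ u, θ' u ∈ Ioo (θ z₁) (θ z₂) ↔ u ∈ Ioo z₁ z₂ := fun u => by
      simp [← hθ' z₁ hz₁, ← hθ' z₂ hz₂]
    obtain ⟨e, he, hfix⟩ := exists_orderIso_moving ((hIoo r).2 hr) hs
    refine ⟨θ'.trans e, fun z hzZ => ?_, fun r' hr' => ?_⟩
    · rw [OrderIso.trans_apply, hfix _ fun hmem => hfree z ((hIoo z).1 hmem) hzZ, hθ' z hzZ]
    · rw [OrderIso.trans_apply]
      rcases Finset.mem_insert.1 hr' with rfl | hr'S
      · rw [he, hbs]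
      rw [hfix _ fun hmem => ?_, hroots r' hr'S]
      have : r' = r := hinj (Ioo_subset_Icc_self ((hIoo r').1 hmem)) (Ioo_subset_Icc_self hr) <| by
        simp only [hS r' hr', har]
      exact hrS (this ▸ hr'S)

/-- If the roots of `a` go to roots of `b`, the signs of `a` and `b` are matched. -/
lemma sign_eval_eq_of_map_roots {a b : Polynomial ℝ} {θ : ℝ ≃o ℝ} {Z : Finset ℝ}
    (hder : ∀ t, SignType.sign (a.derivative.eval t) = SignType.sign (b.derivative.eval (θ t)))
    (hZ : ∀ t, a.derivative.eval t = 0 → t ∈ Z)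
    (hsign : ∀ z ∈ Z, SignType.sign (a.eval z) = SignType.sign (b.eval (θ z)))
    (hroots : ∀ r, a.eval r = 0 → b.eval (θ r) = 0) {t : ℝ} (hlo : ∃ z ∈ Z, z < t)
    (hhi : ∃ z ∈ Z, t < z) :
    SignType.sign (a.eval t) = SignType.sign (b.eval (θ t)) := by
  by_cases htZ : t ∈ Z
  · exact hsign t htZ
  obtain ⟨z₁, hz₁, z₂, hz₂, ht, hfree⟩ := exists_adjacent htZ hlo hhi
  have hmono := strictMonoOn_and_or_strictAntiOn_and hder (z₁ := z₁) (z₂ := z₂)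
      fun u hu h0 => hfree u hu (hZ u h0)
  clear hder hZ
  wlog h : StrictMonoOn (fun t => a.eval t) (Icc z₁ z₂) ∧
      StrictMonoOn (fun t => b.eval t) (Icc (θ z₁) (θ z₂)) generalizing a b
  · have h' := hmono.resolve_left h
    have := this (a := -a) (b := -b) (by simpa [Left.sign_neg] using hsign) (by simpa using hroots)
      (Or.inl ⟨by simpa using h'.1.neg, by simpa using h'.2.neg⟩)
      ⟨by simpa using h'.1.neg, by simpa using h'.2.neg⟩
    simpa [Left.sign_neg] using this
  obtain ⟨ha, hb⟩ := h
  have hz : z₁ < z₂ := ht.1.trans ht.2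
  have hm1 := left_mem_Icc.2 hz.le
  have hm2 := right_mem_Icc.2 hz.le
  have hθm : ∀ u ∈ Icc z₁ z₂, θ u ∈ Icc (θ z₁) (θ z₂) := fun u hu =>
    ⟨θ.monotone hu.1, θ.monotone hu.2⟩
  have hmt := Ioo_subset_Icc_self ht
  have mono : ∀ u ∈ Icc z₁ z₂, ∀ w ∈ Icc z₁ z₂, u < w →
      a.eval u < a.eval w ∧ b.eval (θ u) < b.eval (θ w) := fun u hu w hw huw =>
    ⟨ha hu hw huw, hb (hθm u hu) (hθm w hw) (θ.strictMono huw)⟩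
  obtain ⟨hn1, hp1, h01⟩ := sign_eq_neg_iff_of_sign_eq (hsign z₁ hz₁)
  obtain ⟨hn2, hp2, h02⟩ := sign_eq_neg_iff_of_sign_eq (hsign z₂ hz₂)
  have m1 := mono z₁ hm1 t hmt ht.1
  have m2 := mono t hmt z₂ hm2 ht.2
  rcases le_or_gt 0 (a.eval z₁) with h1 | h1
  · have h1' : 0 ≤ b.eval (θ z₁) := not_lt.1 (hn1.not.1 (not_lt.2 h1))
    rw [sign_pos (h1.trans_lt m1.1), sign_pos (h1'.trans_lt m1.2)]
  rcases le_or_gt (a.eval z₂) 0 with h2 | h2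
  · have h2' : b.eval (θ z₂) ≤ 0 := not_lt.1 (hp2.not.1 (not_lt.2 h2))
    rw [sign_neg (m2.1.trans_le h2), sign_neg (m2.2.trans_le h2')]
  obtain ⟨r, hr, har⟩ := intermediate_value_Ioo hz.le a.continuous.continuousOn ⟨h1, h2⟩
  simp only at har
  have hbr := hroots r har
  have hmr := Ioo_subset_Icc_self hr
  rcases lt_trichotomy t r with htr | rfl | htr
  · have := mono t hmt r hmr htr
    rw [har, hbr] at this
    rw [sign_neg this.1, sign_neg this.2]
  · rw [har, hbr]
  · have := mono r hmr t hmt htr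
    rw [har, hbr] at this
    rw [sign_pos this.1, sign_pos this.2]

/-- Extending a sign matching to one further pair of polynomials. -/
lemma exists_orderIso_sign_eval_eq_insert {K : Type*} {P : Finset K} {u w : K → Polynomial ℝ}
    {a b : Polynomial ℝ} (ha : 0 < a.natDegree) (hb : 0 < b.natDegree) {θ : ℝ ≃o ℝ}
    (hP : ∀ k ∈ P, ∀ t, SignType.sign ((u k).eval t) = SignType.sign ((w k).eval (θ t)))
    (hder : ∃ k ∈ P, u k = a.derivative ∧ w k = b.derivative)
    (hroot : ∀ k ∈ P, u k ≠ 0 → ∀ t, (u k).eval t = 0 →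
      SignType.sign (a.eval t) = SignType.sign (b.eval (θ t))) :
    ∃ θ' : ℝ ≃o ℝ,
      (∀ k ∈ P, ∀ t, SignType.sign ((u k).eval t) = SignType.sign ((w k).eval (θ' t))) ∧
      ∀ t, SignType.sign (a.eval t) = SignType.sign (b.eval (θ' t)) := by
  classical
  obtain ⟨Na, hNa⟩ := exists_forall_le_sign_eval_eq ha
  obtain ⟨Nb, hNb⟩ := exists_forall_le_sign_eval_eq hb
  obtain ⟨Ma, hMa⟩ := exists_forall_ge_sign_eval_eq ha
  obtain ⟨Mb, hMb⟩ := exists_forall_ge_sign_eval_eq hb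
  obtain ⟨k₀, hk₀, huk₀, hwk₀⟩ := hder
  have hder : ∀ t,
      SignType.sign (a.derivative.eval t) = SignType.sign (b.derivative.eval (θ t)) := fun t => by
    rw [← huk₀, ← hwk₀]
    exact hP k₀ hk₀ t
  have ha0 : a ≠ 0 := fun h => by simp [h] at ha
  have hda0 : a.derivative ≠ 0 := fun h => by
    have := Polynomial.derivative_eq_zero.1 h
    omega
  obtain ⟨lo, hlo⟩ : ∃ lo : ℝ, (lo ≤ Na ∧ θ lo ≤ Nb) ∧ ∀ r ∈ a.roots.toFinset, lo < r := by
    obtain ⟨l, hl⟩ := (a.roots.toFinset.finite_toSet).bddBelow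
    refine ⟨min (min Na (θ.symm Nb)) (l - 1), ⟨?_, ?_⟩, fun r hr => ?_⟩
    · exact (min_le_left _ _).trans (min_le_left _ _)
    · rw [← θ.le_symm_apply]
      exact (min_le_left _ _).trans (min_le_right _ _)
    · have := hl (Finset.mem_coe.2 hr)
      exact (min_le_right _ _).trans_lt (by linarith)
  obtain ⟨hi, hhi⟩ : ∃ hi : ℝ, (Ma ≤ hi ∧ Mb ≤ θ hi) ∧ ∀ r ∈ a.roots.toFinset, r < hi := by
    obtain ⟨l, hl⟩ := (a.roots.toFinset.finite_toSet).bddAbove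
    refine ⟨max (max Ma (θ.symm Mb)) (l + 1), ⟨?_, ?_⟩, fun r hr => ?_⟩
    · exact (le_max_left _ _).trans (le_max_left _ _)
    · rw [← θ.symm_apply_le]
      exact (le_max_right _ _).trans (le_max_left _ _)
    · have := hl (Finset.mem_coe.2 hr)
      exact lt_of_lt_of_le (by linarith) (le_max_right _ _)
  have hbelow : ∀ (θ' : ℝ ≃o ℝ) t, (∀ t, SignType.sign (a.derivative.eval t) =
      SignType.sign (b.derivative.eval (θ' t))) → θ' lo = θ lo → t ≤ lo →
      SignType.sign (a.eval t) = SignType.sign (b.eval (θ' t)) := fun θ' t hd he ht => by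
    rw [hNa t (ht.trans hlo.1.1), hNb _ (((θ'.monotone ht).trans he.le).trans hlo.1.2), hd]
  have habove : ∀ (θ' : ℝ ≃o ℝ) t, (∀ t, SignType.sign (a.derivative.eval t) =
      SignType.sign (b.derivative.eval (θ' t))) → θ' hi = θ hi → hi ≤ t →
      SignType.sign (a.eval t) = SignType.sign (b.eval (θ' t)) := fun θ' t hd he ht => by
    rw [hMa t (hhi.1.1.trans ht), hMb _ (hhi.1.2.trans (he.ge.trans (θ'.monotone ht))), hd]
  let Z : Finset ℝ := insert lo (insert hi (P.biUnion fun k => (u k).roots.toFinset))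
  have hloZ : lo ∈ Z := by simp [Z]
  have hhiZ : hi ∈ Z := by simp [Z]
  have hPZ : ∀ k ∈ P, u k ≠ 0 → ∀ t, (u k).eval t = 0 → t ∈ Z := fun k hk hne t ht => by
    simp only [Z, Finset.mem_insert, Finset.mem_biUnion, Multiset.mem_toFinset]
    exact Or.inr (Or.inr ⟨k, hk, (Polynomial.mem_roots hne).2 ht⟩)
  have hdZ : ∀ t, a.derivative.eval t = 0 → t ∈ Z := fun t ht =>
    hPZ k₀ hk₀ (huk₀ ▸ hda0) t (huk₀ ▸ ht)
  have hsign : ∀ z ∈ Z, SignType.sign (a.eval z) = SignType.sign (b.eval (θ z)) := by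
    intro z hz
    simp only [Z, Finset.mem_insert, Finset.mem_biUnion, Multiset.mem_toFinset] at hz
    rcases hz with rfl | rfl | ⟨k, hk, hz⟩
    · exact hbelow θ z hder rfl le_rfl
    · exact habove θ z hder rfl le_rfl
    · exact hroot k hk (Polynomial.ne_zero_of_mem_roots hz) z (Polynomial.isRoot_of_mem_roots hz)
  have hmem : ∀ r, a.eval r = 0 → r ∈ a.roots.toFinset := fun r hr => by
    simpa [ha0] using hr
  obtain ⟨θ', hθ', hroots⟩ := exists_orderIso_map_roots hder hdZ hsign
    (fun r hr => ⟨lo, hloZ, hlo.2 r (hmem r hr)⟩) (fun r hr => ⟨hi, hhiZ, hhi.2 r (hmem r hr)⟩)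
    a.roots.toFinset fun r hr => by simpa [ha0] using hr
  have hP' : ∀ k ∈ P, ∀ t,
      SignType.sign ((u k).eval t) = SignType.sign ((w k).eval (θ' t)) := fun k hk =>
    sign_eval_eq_of_eqOn_roots (hP k hk) (hPZ k hk) hθ'
  have hder' : ∀ t,
      SignType.sign (a.derivative.eval t) = SignType.sign (b.derivative.eval (θ' t)) := fun t => by
    rw [← huk₀, ← hwk₀]
    exact hP' k₀ hk₀ t
  refine ⟨θ', hP', fun t => ?_⟩
  rcases le_or_gt t lo with htlo | htlo
  · exact hbelow θ' t hder' (hθ' lo hloZ) htlo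
  rcases le_or_gt hi t with hthi | hthi
  · exact habove θ' t hder' (hθ' hi hhiZ) hthi
  exact sign_eval_eq_of_map_roots hder' hdZ (fun z hz => by rw [hθ' z hz, hsign z hz])
    (fun r hr => hroots r (hmem r hr)) ⟨lo, hloZ, htlo⟩ ⟨hi, hhiZ, hthi⟩

lemma exists_pseudo_division {R : Type*} [CommRing R] {q : Polynomial R} {e : ℕ}
    (hq : q.natDegree ≤ e) (p : Polynomial R) :
    ∃ (N : ℕ) (A ρ : Polynomial R),
      Polynomial.C (q.coeff e ^ N) * p = A * q + ρ ∧ ρ.degree < e := by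
  suffices H : ∀ k : ℕ, ∀ p : Polynomial R, p.degree < k → ∃ (N : ℕ) (A ρ : Polynomial R),
      Polynomial.C (q.coeff e ^ N) * p = A * q + ρ ∧ ρ.degree < e from
    H (p.natDegree + 1) p (by
      exact_mod_cast p.degree_le_natDegree.trans_lt (by exact_mod_cast Nat.lt_succ_self _))
  intro k
  induction k with
  | zero => exact fun p hp => ⟨0, 0, p, by simp, hp.trans_le (by exact_mod_cast Nat.zero_le e)⟩
  | succ k ih =>
    intro p hp
    rcases lt_or_ge k e with hk | hk
    · exact ⟨0, 0, p, by simp, hp.trans_le (by exact_mod_cast hk)⟩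
    obtain ⟨N, A, ρ, h, hρ⟩ := ih (Polynomial.C (q.coeff e) * p -
        Polynomial.C (p.coeff k) * (Polynomial.X ^ (k - e) * q)) <| by
      rw [Polynomial.degree_lt_iff_coeff_zero] at hp ⊢
      intro m hm
      rw [Polynomial.coeff_sub, Polynomial.coeff_C_mul, Polynomial.coeff_C_mul,
        Polynomial.coeff_X_pow_mul', if_pos (by omega)]
      rcases hm.eq_or_lt with rfl | hm
      · rw [Nat.sub_sub_self hk]
        ring
      · rw [hp m hm, Polynomial.coeff_eq_zero_of_natDegree_lt (p := q) (n := m - (k - e)) (by omega)]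
        ring
    refine ⟨N + 1, A + Polynomial.C (q.coeff e ^ N * p.coeff k) * Polynomial.X ^ (k - e), ρ, ?_, hρ⟩
    simp only [map_pow, map_mul] at h ⊢
    linear_combination h

/-- The signs of finitely many coefficient expressions determine, up to an order automorphism of
the line, the signs of the polynomials in `P`. -/
def SignDetermined {R : Type*} [CommRing R] (P : Finset (Polynomial R)) : Prop :=
  ∃ Q : Finset R, ∀ x y : R →+* ℝ, (∀ c ∈ Q, SignType.sign (x c) = SignType.sign (y c)) →
    ∃ θ : ℝ ≃o ℝ, ∀ p ∈ P, ∀ t,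
      SignType.sign ((p.map x).eval t) = SignType.sign ((p.map y).eval (θ t))

lemma map_trunc_eq {R : Type*} [CommRing R] {q : Polynomial R} {x : R →+* ℝ} {e : ℕ}
    (h : ∀ i, e ≤ i → x (q.coeff i) = 0) :
    (PowerSeries.trunc e (q : PowerSeries R)).map x = q.map x := by
  ext i
  rw [Polynomial.coeff_map, Polynomial.coeff_map, PowerSeries.coeff_trunc]
  split_ifs with hi
  · simp
  · rw [map_zero, h i (not_lt.1 hi)]

lemma sign_eval_eq_of_pseudo_division {R : Type*} [CommRing R] {x y : R →+* ℝ}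
    {p q A ρ : Polynomial R} {c : R} {N : ℕ} (h : Polynomial.C (c ^ N) * p = A * q + ρ)
    (hc : SignType.sign (x c) = SignType.sign (y c)) (hc0 : x c ≠ 0) {t u : ℝ}
    (ht : (q.map x).eval t = 0) (hu : (q.map y).eval u = 0)
    (hρ : SignType.sign ((ρ.map x).eval t) = SignType.sign ((ρ.map y).eval u)) :
    SignType.sign ((p.map x).eval t) = SignType.sign ((p.map y).eval u) := by
  have hx := congrArg (fun P => (P.map x).eval t) h
  have hy := congrArg (fun P => (P.map y).eval u) h
  simp only [Polynomial.map_mul, Polynomial.map_add, Polynomial.map_C, Polynomial.eval_mul,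
    Polynomial.eval_add, Polynomial.eval_C, ht, hu, mul_zero, zero_add] at hx hy
  rw [← hx, ← hy, map_pow, map_pow, sign_mul, sign_mul, sign_pow, sign_pow, hc] at hρ
  have hne : SignType.sign (y c) ^ N ≠ 0 :=
    pow_ne_zero _ (by rw [← hc]; exact sign_ne_zero.2 hc0)
  exact mul_left_cancel₀ hne hρ

lemma signDetermined_insert {R : Type*} [CommRing R] [DecidableEq (Polynomial R)] {d : ℕ}
    {p : Polynomial R} {W : Finset (Polynomial R)} (hp : p.degree < (d + 1 : ℕ))
    (hW : ∀ q ∈ W, q.degree < (d + 1 : ℕ)) (hder : p.derivative ∈ W)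
    (H : ∀ L : Finset (Polynomial R), (∀ q ∈ L, q.degree < d) → SignDetermined (L ∪ W)) :
    SignDetermined (insert p W) := by
  classical
  have hdiv : ∀ (q : Polynomial R) (e : ℕ), ∃ (N : ℕ) (A ρ : Polynomial R),
      Polynomial.C (q.coeff e ^ N) * p =
        A * PowerSeries.trunc (e + 1) (q : PowerSeries R) + ρ ∧ ρ.degree < e := fun q e => by
    have hdeg : (PowerSeries.trunc (e + 1) (q : PowerSeries R)).natDegree ≤ e :=
      Nat.lt_succ_iff.1 (PowerSeries.natDegree_trunc_lt _ _)
    simpa [PowerSeries.coeff_trunc] using exists_pseudo_division hdeg p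
  choose N A ρ hρ hρdeg using hdiv
  obtain ⟨Q, hQ⟩ := H (insert (PowerSeries.trunc d (p : PowerSeries R))
      ((W ×ˢ Finset.range (d + 1)).image fun k => ρ k.1 k.2)) <| by
    intro q hq
    rcases Finset.mem_insert.1 hq with rfl | hq
    · exact PowerSeries.degree_trunc_lt _ _
    · obtain ⟨⟨k, e⟩, hk, rfl⟩ := Finset.mem_image.1 hq
      have he := (Finset.mem_product.1 hk).2
      rw [Finset.mem_range, Nat.lt_succ_iff] at he
      exact (hρdeg k e).trans_le (by exact_mod_cast he)
  refine ⟨Q ∪ (insert p W).biUnion fun q => (Finset.range (d + 1)).image q.coeff,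
    fun x y hxy => ?_⟩
  have hWp : ∀ q ∈ insert p W, q.degree < (d + 1 : ℕ) :=
    Finset.forall_mem_insert _ _ _ |>.2 ⟨hp, hW⟩
  have hcoeff0 : ∀ q ∈ insert p W, ∀ i, d + 1 ≤ i → q.coeff i = 0 := fun q hq =>
    (Polynomial.degree_lt_iff_coeff_zero _ _).1 (hWp q hq)
  have hcoeff : ∀ q ∈ insert p W, ∀ i,
      SignType.sign (x (q.coeff i)) = SignType.sign (y (q.coeff i)) := fun q hq i => by
    rcases lt_or_ge i (d + 1) with hi | hi
    · exact hxy _ (Finset.mem_union_right _ (Finset.mem_biUnion.2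
        ⟨q, hq, Finset.mem_image_of_mem _ (Finset.mem_range.2 hi)⟩))
    · simp [hcoeff0 q hq i hi]
  have hcoeff_zero : ∀ q ∈ insert p W, ∀ i, x (q.coeff i) = 0 → y (q.coeff i) = 0 :=
    fun q hq i h => by rw [← sign_eq_zero_iff, ← hcoeff q hq, h, sign_zero]
  obtain ⟨θ, hθ⟩ := hQ x y fun c hc => hxy c (Finset.mem_union_left _ hc)
  have hpm := Finset.mem_insert_self p W
  by_cases hpd : x (p.coeff d) = 0
  · refine ⟨θ, fun q hq t => ?_⟩
    rcases Finset.mem_insert.1 hq with rfl | hqW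
    · have hx : ∀ i, d ≤ i → x (q.coeff i) = 0 := fun i hi => by
        rcases hi.eq_or_lt with rfl | hi
        · exact hpd
        · rw [hcoeff0 q hq i hi, map_zero]
      have := hθ (PowerSeries.trunc d (q : PowerSeries R)) (by simp) t
      rwa [map_trunc_eq hx, map_trunc_eq fun i hi => hcoeff_zero q hq i (hx i hi)] at this
    · exact hθ q (Finset.mem_union_right _ hqW) t
  have hdeg : ∀ z : R →+* ℝ, z (p.coeff d) ≠ 0 → (p.map z).natDegree = d := fun z hz => by
    refine le_antisymm (Polynomial.natDegree_le_iff_coeff_eq_zero.2 fun i hi => ?_)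
      (Polynomial.le_natDegree_of_ne_zero (by rwa [Polynomial.coeff_map]))
    rw [Polynomial.coeff_map, hcoeff0 p hpm i hi, map_zero]
  have hpdy : y (p.coeff d) ≠ 0 := by
    rw [← sign_ne_zero, ← hcoeff p hpm, sign_ne_zero]
    exact hpd
  rcases Nat.eq_zero_or_pos d with rfl | hd
  · refine ⟨θ, fun q hq t => ?_⟩
    rcases Finset.mem_insert.1 hq with rfl | hqW
    · rw [Polynomial.eq_C_of_natDegree_eq_zero (hdeg x hpd),
        Polynomial.eq_C_of_natDegree_eq_zero (hdeg y hpdy)]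
      simpa using hcoeff q hq 0
    · exact hθ q (Finset.mem_union_right _ hqW) t
  obtain ⟨θ', hθ', hp'⟩ := exists_orderIso_sign_eval_eq_insert (P := W)
      (u := fun q => q.map x) (w := fun q => q.map y) (a := p.map x) (b := p.map y)
      (by rwa [hdeg x hpd]) (by rwa [hdeg y hpdy]) (θ := θ)
      (fun q hq => hθ q (Finset.mem_union_right _ hq))
      ⟨_, hder, by simp [Polynomial.derivative_map], by simp [Polynomial.derivative_map]⟩ <| by
    intro q hq hne t ht
    have hqm : q ∈ insert p W := Finset.mem_insert_of_mem hq
    set e := (q.map x).natDegree with he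
    have hce : x (q.coeff e) ≠ 0 := by
      rw [← Polynomial.coeff_map, he]
      exact Polynomial.leadingCoeff_ne_zero.2 hne
    have hx : ∀ i, e + 1 ≤ i → x (q.coeff i) = 0 := fun i hi => by
      rw [← Polynomial.coeff_map]
      exact Polynomial.coeff_eq_zero_of_natDegree_lt hi
    have hed : e < d + 1 := by
      by_contra! h
      exact hce (by rw [hcoeff0 q hqm e h, map_zero])
    refine sign_eval_eq_of_pseudo_division (hρ q e) (hcoeff q hqm e) hce ?_ ?_
      (hθ _ (Finset.mem_union_left _ (Finset.mem_insert_of_mem (Finset.mem_image.2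
        ⟨(q, e), Finset.mem_product.2 ⟨hq, Finset.mem_range.2 hed⟩, rfl⟩))) t)
    · rwa [map_trunc_eq hx]
    · rw [map_trunc_eq fun i hi => hcoeff_zero q hqm i (hx i hi), ← sign_eq_zero_iff,
        ← hθ q (Finset.mem_union_right _ hq), ht, sign_zero]
  refine ⟨θ', fun q hq t => ?_⟩
  rcases Finset.mem_insert.1 hq with rfl | hqW
  exacts [hp' t, hθ' q hqW t]

lemma SignDetermined.mono {R : Type*} [CommRing R] {P P' : Finset (Polynomial R)}
    (h : SignDetermined P') (hP : P ⊆ P') : SignDetermined P := by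
  obtain ⟨Q, hQ⟩ := h
  refine ⟨Q, fun x y hxy => ?_⟩
  obtain ⟨θ, hθ⟩ := hQ x y hxy
  exact ⟨θ, fun p hp => hθ p (hP hp)⟩

theorem signDetermined {R : Type*} [CommRing R] (P : Finset (Polynomial R)) :
    SignDetermined P := by
  classical
  suffices H : ∀ d : ℕ, ∀ P : Finset (Polynomial R), (∀ p ∈ P, p.degree < d) →
      SignDetermined P by
    refine H (P.sup Polynomial.natDegree + 1) P fun p hp => ?_
    refine p.degree_le_natDegree.trans_lt ?_
    exact_mod_cast Nat.lt_succ_of_le (Finset.le_sup (f := Polynomial.natDegree) hp)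
  intro d
  induction d with
  | zero =>
    refine fun P hP => ⟨∅, fun x y _ => ⟨OrderIso.refl ℝ, fun p hp t => ?_⟩⟩
    have : p = 0 := Polynomial.degree_eq_bot.1 (by simpa using hP p hp)
    simp [this]
  | succ d ih =>
    intro T
    suffices H : (∀ p ∈ T, p.degree < (d + 1 : ℕ)) → ∀ L : Finset (Polynomial R),
        (∀ p ∈ L, p.degree < d) → SignDetermined (L ∪ T) from
      fun hT => by simpa using H hT ∅ (by simp)
    induction T using Finset.induction_on with
    | empty => exact fun _ L hL => by simpa using ih L hL
    | insert p T _ ihT =>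
      intro hT L hL
      have hp := hT p (Finset.mem_insert_self _ _)
      have hT' := fun q hq => hT q (Finset.mem_insert_of_mem hq)
      have hlt : ∀ q : Polynomial R, q.degree < d → q.degree < (d + 1 : ℕ) := fun q hq =>
        hq.trans (by exact_mod_cast Nat.lt_succ_self d)
      have hder : p.derivative.degree < d := by
        rw [Polynomial.degree_lt_iff_coeff_zero] at hp ⊢
        intro m hm
        rw [Polynomial.coeff_derivative, hp (m + 1) (by omega), zero_mul]
      refine (signDetermined_insert (d := d) (p := p) (W := insert p.derivative (L ∪ T)) hp ?_
        (Finset.mem_insert_self _ _) fun L' hL' => ?_).mono ?_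
      · intro q hq
        rcases Finset.mem_insert.1 hq with rfl | hq
        · exact hlt _ hder
        rcases Finset.mem_union.1 hq with hq | hq
        exacts [hlt q (hL q hq), hT' q hq]
      · refine (ihT hT' (insert p.derivative (L' ∪ L)) fun q hq => ?_).mono fun q hq => ?_
        · rcases Finset.mem_insert.1 hq with rfl | hq
          · exact hder
          rcases Finset.mem_union.1 hq with hq | hq
          exacts [hL' q hq, hL q hq]
        · simp only [Finset.mem_union, Finset.mem_insert] at hq ⊢
          tauto
      · intro q hq
        simp only [Finset.mem_union, Finset.mem_insert] at hq ⊢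
        tauto

/-- A predicate on `ι → ℝ` which only depends on the signs of finitely many polynomials; that is,
a semialgebraic set. -/
def SignDefinable {ι : Type*} (S : (ι → ℝ) → Prop) : Prop :=
  ∃ Q : Finset (MvPolynomial ι ℝ), ∀ x y : ι → ℝ,
    (∀ q ∈ Q, SignType.sign (eval x q) = SignType.sign (eval y q)) → S x → S y

/-- A function on `ι → ℝ` given by a polynomial. -/
def IsPolynomialFun {ι : Type*} (u : (ι → ℝ) → ℝ) : Prop :=
  ∃ p : MvPolynomial ι ℝ, ∀ x, eval x p = u x

namespace IsPolynomialFun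

variable {ι κ : Type*} {u : (ι → ℝ) → ℝ}

lemma coord (i : ι) : IsPolynomialFun fun x : ι → ℝ => x i := ⟨X i, fun _ => eval_X i⟩

lemma const (c : ℝ) : IsPolynomialFun fun _ : ι → ℝ => c := ⟨C c, fun _ => eval_C c⟩

lemma neg (hu : IsPolynomialFun u) : IsPolynomialFun fun x => -u x := by
  obtain ⟨p, hp⟩ := hu
  exact ⟨-p, fun x => by rw [map_neg, hp]⟩

lemma pow (hu : IsPolynomialFun u) (k : ℕ) : IsPolynomialFun fun x => u x ^ k := by
  obtain ⟨p, hp⟩ := hu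
  exact ⟨p ^ k, fun x => by rw [map_pow, hp]⟩

lemma eval_comp {w : (ι → ℝ) → κ → ℝ} (hw : ∀ k, IsPolynomialFun fun x => w x k)
    (p : MvPolynomial κ ℝ) : IsPolynomialFun fun x => eval (w x) p := by
  choose q hq using hw
  refine ⟨bind₁ q p, fun x => ?_⟩
  change _ = eval (w x) p
  rw [← show (fun k => eval x (q k)) = w x from funext fun k => hq k x]
  exact eval₂Hom_bind₁ _ _ _ _

end IsPolynomialFun

namespace SignDefinable

variable {ι κ : Type*} {S T : (ι → ℝ) → Prop}

lemma not (hS : SignDefinable S) : SignDefinable fun x => ¬S x := by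
  obtain ⟨Q, hQ⟩ := hS
  exact ⟨Q, fun x y hxy hx hy => hx (hQ y x (fun q hq => (hxy q hq).symm) hy)⟩

lemma forall_finite {α : Type*} [Finite α] {S : α → (ι → ℝ) → Prop}
    (hS : ∀ a, SignDefinable (S a)) : SignDefinable fun x => ∀ a, S a x := by
  classical
  have := Fintype.ofFinite α
  choose Q hQ using hS
  exact ⟨Finset.univ.biUnion Q, fun x y hxy h a => hQ a x y
    (fun q hq => hxy q (Finset.mem_biUnion.2 ⟨a, Finset.mem_univ a, hq⟩)) (h a)⟩

lemma and (hS : SignDefinable S) (hT : SignDefinable T) : SignDefinable fun x => S x ∧ T x := by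
  classical
  obtain ⟨P, hP⟩ := hS
  obtain ⟨Q, hQ⟩ := hT
  exact ⟨P ∪ Q, fun x y hxy h =>
    ⟨hP x y (fun q hq => hxy q (Finset.mem_union_left _ hq)) h.1,
      hQ x y (fun q hq => hxy q (Finset.mem_union_right _ hq)) h.2⟩⟩

lemma congr (hS : SignDefinable S) (h : ∀ x, T x ↔ S x) : SignDefinable T := by
  rwa [funext fun x => propext (h x)]

lemma imp (hS : SignDefinable S) (hT : SignDefinable T) : SignDefinable fun x => S x → T x :=
  (hS.and hT.not).not.congr fun x => by tauto

lemma le {u w : (ι → ℝ) → ℝ} (hu : IsPolynomialFun u) (hw : IsPolynomialFun w) :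
    SignDefinable fun x => u x ≤ w x := by
  obtain ⟨p, hp⟩ := hu
  obtain ⟨q, hq⟩ := hw
  refine ⟨{q - p}, fun x y hxy h => ?_⟩
  have := (sign_eq_neg_iff_of_sign_eq (hxy _ (Finset.mem_singleton_self _))).1.not
  rw [map_sub, map_sub, hp, hp, hq, hq, not_lt, not_lt, sub_nonneg, sub_nonneg] at this
  exact this.1 h

lemma lt {u w : (ι → ℝ) → ℝ} (hu : IsPolynomialFun u) (hw : IsPolynomialFun w) :
    SignDefinable fun x => u x < w x :=
  (le hw hu).not.congr fun _ => not_le.symm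

lemma comp (hS : SignDefinable S) {w : (κ → ℝ) → ι → ℝ}
    (hw : ∀ i, IsPolynomialFun fun x => w x i) : SignDefinable fun x => S (w x) := by
  classical
  obtain ⟨Q, hQ⟩ := hS
  choose p hp using fun q : MvPolynomial ι ℝ => IsPolynomialFun.eval_comp hw q
  refine ⟨Q.image p, fun x y hxy => hQ _ _ fun q hq => ?_⟩
  beta_reduce at hp
  rw [← hp, ← hp]
  exact hxy _ (Finset.mem_image_of_mem _ hq)

lemma eval_map_optionEquivLeft (x : ι → ℝ) (t : ℝ) (q : MvPolynomial (Option ι) ℝ) :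
    ((optionEquivLeft ℝ ι q).map (eval x)).eval t = eval (fun o => o.elim t x) q := by
  induction q using MvPolynomial.induction_on with
  | C a => simp [optionEquivLeft_C]
  | add p q hp hq => simp [hp, hq]
  | mul_X p i hp => cases i <;> simp [hp, optionEquivLeft_X_none, optionEquivLeft_X_some]

/-- The Tarski–Seidenberg theorem, for the elimination of one variable. -/
lemma exists_option {S : (Option ι → ℝ) → Prop} (hS : SignDefinable S) :
    SignDefinable fun x : ι → ℝ => ∃ t, S fun o => o.elim t x := by
  classical
  obtain ⟨Q, hQ⟩ := hS
  obtain ⟨Q', hQ'⟩ := signDetermined (Q.image (optionEquivLeft ℝ ι))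
  refine ⟨Q', fun x y hxy ⟨t, ht⟩ => ?_⟩
  obtain ⟨θ, hθ⟩ := hQ' (eval x) (eval y) hxy
  refine ⟨θ t, hQ _ _ (fun q hq => ?_) ht⟩
  have := hθ _ (Finset.mem_image_of_mem _ hq) t
  rwa [eval_map_optionEquivLeft, eval_map_optionEquivLeft] at this

lemma exists_sumElim (κ : Type*) [Finite κ] : ∀ {S : (ι ⊕ κ → ℝ) → Prop}, SignDefinable S →
    SignDefinable fun x : ι → ℝ => ∃ w : κ → ℝ, S (Sum.elim x w) := by
  induction κ using Finite.induction_empty_option with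
  | of_equiv e ih =>
    intro S hS
    refine (ih (hS.comp (w := fun y => y ∘ Sum.map id e.symm) fun _ => .coord _)).congr
      fun x => ?_
    constructor
    · rintro ⟨w, hw⟩
      refine ⟨w ∘ e, ?_⟩
      convert hw using 1
      ext (i | k) <;> simp
    · rintro ⟨w, hw⟩
      refine ⟨w ∘ e.symm, ?_⟩
      convert hw using 1
      ext (i | k) <;> simp
  | h_empty =>
    intro S hS
    refine (hS.comp (w := fun x : ι → ℝ => Sum.elim x PEmpty.elim) ?_).congr fun x => ?_
    · rintro (i | k)
      · exact .coord i
      · exact k.elim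
    · exact ⟨fun ⟨w, hw⟩ => by rwa [Subsingleton.elim PEmpty.elim w], fun h => ⟨_, h⟩⟩
  | h_option ih =>
    intro S hS
    refine (ih (hS.comp (w := fun (y : Option (ι ⊕ _) → ℝ) => Sum.elim (fun i => y (some (.inl i)))
      fun o => y (o.map Sum.inr)) ?_).exists_option).congr fun x => ?_
    · rintro (i | _ | k) <;> exact .coord _
    constructor
    · rintro ⟨w, hw⟩
      refine ⟨fun k => w (some k), w none, ?_⟩
      convert hw using 1
      ext (i | _ | k) <;> rfl
    · rintro ⟨w, t, hw⟩
      refine ⟨fun o => o.elim t w, ?_⟩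
      convert hw using 1
      ext (i | _ | k) <;> rfl

lemma exists_vector [Finite κ] {S : (ι → ℝ) → (κ → ℝ) → Prop}
    (hS : SignDefinable fun y : ι ⊕ κ → ℝ => S (y ∘ Sum.inl) (y ∘ Sum.inr)) :
    SignDefinable fun x => ∃ w, S x w :=
  exists_sumElim κ hS

lemma forall_vector [Finite κ] {S : (ι → ℝ) → (κ → ℝ) → Prop}
    (hS : SignDefinable fun y : ι ⊕ κ → ℝ => S (y ∘ Sum.inl) (y ∘ Sum.inr)) :
    SignDefinable fun x => ∀ w, S x w :=
  (exists_vector (S := fun x w => ¬S x w) hS.not).not.congr fun x => by push Not; rfl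

/-- A countable semialgebraic subset of the line is finite. -/
lemma finite_of_countable {D : Set ℝ} (hD : SignDefinable fun x : Unit → ℝ => x () ∈ D)
    (hcount : D.Countable) : D.Finite := by
  classical
  obtain ⟨Q, hQ⟩ := hD
  let P : MvPolynomial Unit ℝ → Polynomial ℝ := aeval fun _ => Polynomial.X
  have hP : ∀ q t, (P q).eval t = eval (fun _ => t) q := fun q t => by
    induction q using MvPolynomial.induction_on with
    | C a => simp [P]
    | add p q hp hq => simp_all [P]
    | mul_X p i hp => simp_all [P]
  refine (Q.biUnion fun q => (P q).roots.toFinset).finite_toSet.subset fun t ht => ?_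
  by_contra hroot
  have hroot : ∀ q ∈ Q, P q ≠ 0 → (P q).eval t ≠ 0 := fun q hq hne h0 => hroot <| by
    simp only [Finset.coe_biUnion, mem_iUnion, Finset.mem_coe, Multiset.mem_toFinset]
    exact ⟨q, hq, (Polynomial.mem_roots hne).2 h0⟩
  have hev : ∀ q ∈ Q, ∀ᶠ u in nhds t,
      SignType.sign ((P q).eval t) = SignType.sign ((P q).eval u) := fun q hq => by
    by_cases hne : P q = 0
    · simp [hne]
    have hc := (P q).continuous.continuousAt (x := t)
    rcases lt_or_gt_of_ne (hroot q hq hne) with h | h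
    · filter_upwards [hc.eventually_lt_const h] with u hu
      rw [sign_neg h, sign_neg hu]
    · filter_upwards [hc.eventually_const_lt h] with u hu
      rw [sign_pos h, sign_pos hu]
  have hmem : D ∈ nhds t := by
    filter_upwards [(Finset.eventually_all Q).2 hev] with u hu
    refine hQ (fun _ => t) (fun _ => u) (fun q hq => ?_) ht
    rw [← hP, ← hP]
    exact hu q hq
  have hint := (hcount.dense_compl ℝ).interior_compl
  rw [compl_compl] at hint
  exact (hint ▸ mem_interior_iff_mem_nhds.2 hmem : t ∈ (∅ : Set ℝ))

/-- The set of parameters at which the value of a parametric minimization problem drops is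
semialgebraic. -/
lemma value_drop [Finite κ] {F : ℝ → (κ → ℝ) → Prop}
    (hF : SignDefinable fun y : Unit ⊕ κ → ℝ => F (y (.inl ())) (y ∘ Sum.inr))
    (f : MvPolynomial κ ℝ) :
    SignDefinable fun x : Unit → ℝ => x () ∈ {ε | ∃ c : ℝ, (∃ z, F ε z ∧ eval z f < c) ∧
      ∀ δ < ε, ∀ z, F δ z → c ≤ eval z f} := by
  have h₁ : SignDefinable fun y : Unit ⊕ Unit → ℝ =>
      ∃ z, F (y (.inl ())) z ∧ eval z f < y (.inr ()) := by
    refine exists_vector (S := fun (y : Unit ⊕ Unit → ℝ) z => F (y (.inl ())) z ∧ eval z f < y (.inr ())) (.and ?_ ?_)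
    · refine hF.comp (w := fun y : (Unit ⊕ Unit) ⊕ κ → ℝ =>
        Sum.elim (fun _ => y (.inl (.inl ()))) (y ∘ .inr)) ?_
      rintro (i | k) <;> exact .coord _
    · exact .lt (.eval_comp (fun _ => .coord _) f) (.coord _)
  have h₂ : SignDefinable fun y : Unit ⊕ Unit → ℝ => ∀ w : Unit ⊕ κ → ℝ,
      w (.inl ()) < y (.inl ()) → F (w (.inl ())) (w ∘ .inr) →
        y (.inr ()) ≤ eval (w ∘ .inr) f := by
    refine forall_vector (S := fun (y : Unit ⊕ Unit → ℝ) (w : Unit ⊕ κ → ℝ) =>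
      w (.inl ()) < y (.inl ()) → F (w (.inl ())) (w ∘ .inr) →
        y (.inr ()) ≤ eval (w ∘ .inr) f) (.imp ?_ (.imp ?_ ?_))
    · exact .lt (.coord _) (.coord _)
    · exact hF.comp (w := fun y : (Unit ⊕ Unit) ⊕ (Unit ⊕ κ) → ℝ => y ∘ .inr) fun _ => .coord _
    · exact .le (.coord _) (.eval_comp (fun _ => .coord _) f)
  refine (exists_sumElim Unit (h₁.and h₂)).congr fun x => ?_
  constructor
  · rintro ⟨c, hc, hδ⟩
    exact ⟨fun _ => c, hc, fun w hw => hδ _ hw _⟩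
  · rintro ⟨c, hc, hδ⟩
    exact ⟨c (), hc, fun δ hlt z => hδ (Sum.elim (fun _ => δ) z) hlt⟩

end SignDefinable

lemma setOf_sq_le_eq_Icc {ι : Type*} {M : ℝ} (hM : 0 < M) :
    {z : ι → ℝ | ∀ i, z i ^ 2 ≤ M} = Icc (fun _ => -√M) fun _ => √M := by
  ext z
  simp only [mem_ofPred_eq, Real.sq_le hM.le, mem_Icc, Pi.le_def, forall_and]

lemma isCompact_setOf_sq_le (ι : Type*) {M : ℝ} (hM : 0 < M) :
    IsCompact {z : ι → ℝ | ∀ i, z i ^ 2 ≤ M} := by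
  rw [setOf_sq_le_eq_Icc hM]
  exact isCompact_Icc

lemma volume_inter_setOf_sq_le_pos {ι : Type*} [Fintype ι] {M : ℝ} (hM : 0 < M)
    {U : Set (ι → ℝ)} (hU : IsOpen U) (hne : (U ∩ {z | ∀ i, z i ^ 2 ≤ M}).Nonempty) :
    0 < volume (U ∩ {z | ∀ i, z i ^ 2 ≤ M}) := by
  have hconv : Convex ℝ {z : ι → ℝ | ∀ i, z i ^ 2 ≤ M} := by
    rw [setOf_sq_le_eq_Icc hM]
    exact convex_Icc _ _
  have hint : (interior {z : ι → ℝ | ∀ i, z i ^ 2 ≤ M}).Nonempty := by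
    refine ⟨0, mem_interior.2 ⟨{z | ∀ i, z i ^ 2 < M}, fun z hz i => (hz i).le, ?_, fun i => ?_⟩⟩
    · rw [ofPred_forall]
      exact isOpen_iInter_of_finite fun i => isOpen_lt (by fun_prop) continuous_const
    · simpa using hM
  obtain ⟨z, hzU, hz⟩ := hne
  have hcl := hconv.closure_interior_eq_closure_of_nonempty_interior hint ▸ subset_closure hz
  have hpos := (hU.inter isOpen_interior).measure_pos volume (mem_closure_iff.1 hcl U hU hzU)
  exact hpos.trans_le (measure_mono (inter_subset_inter_right _ interior_subset))

/-- Convergence in `L¹` yields points of a set of positive measure at which the approximation is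
almost as large as the limit. -/
lemma exists_sub_lt_of_tendsto_integral_abs_sub {α : Type*} [MeasurableSpace α] {μ : Measure α}
    [IsFiniteMeasure μ] {F : ℕ → α → ℝ} {J : α → ℝ} (hint : ∀ k, Integrable (fun z => F k z - J z) μ)
    (hlim : Tendsto (fun k => ∫ z, |F k z - J z| ∂μ) atTop (nhds 0)) {V : Set α} (hV : μ V ≠ 0)
    {c : ℝ} (hc : 0 < c) : ∃ k, 1 ≤ k ∧ ∃ z ∈ V, J z - c < F k z := by
  have hVpos : 0 < μ.real V := ENNReal.toReal_pos hV (measure_ne_top μ V)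
  obtain ⟨k, hk, hk1⟩ :=
    ((hlim.eventually_lt_const (mul_pos hc hVpos)).and (eventually_ge_atTop 1)).exists
  refine ⟨k, hk1, ?_⟩
  by_contra! h
  have hle := mul_meas_ge_le_integral_of_nonneg (ae_of_all μ fun z => abs_nonneg (F k z - J z))
    (hint k).abs c
  have hsub : μ.real V ≤ μ.real {z | c ≤ |F k z - J z|} := measureReal_mono fun z hz => by
    have := h z hz
    exact (by linarith : c ≤ -(F k z - J z)).trans (neg_le_abs _)
  exact absurd (hle.trans_lt hk) (not_lt.2 (mul_le_mul_of_nonneg_left hsub hc.le))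

section OptimalValue

variable {n m s : ℕ} {h : Fin s → MvPolynomial (Fin n ⊕ Fin m) ℝ}
  {φ : MvPolynomial (Fin n ⊕ (Fin m ⊕ Fin m)) ℝ} {M : ℝ} {J : (Fin n ⊕ Fin m → ℝ) → ℝ}

lemma continuous_eval_sumElim₂ (φ : MvPolynomial (Fin n ⊕ (Fin m ⊕ Fin m)) ℝ) :
    Continuous fun p : (Fin n ⊕ Fin m → ℝ) × (Fin m → ℝ) =>
      eval (Sum.elim (p.1 ∘ Sum.inl) (Sum.elim (p.1 ∘ Sum.inr) p.2)) φ := by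
  refine (continuous_eval φ).comp (continuous_pi fun k => ?_)
  rcases k with i | i | i <;> simp <;> fun_prop

lemma continuous_eval_sumElim (q : MvPolynomial (Fin n ⊕ Fin m) ℝ) :
    Continuous fun p : (Fin n ⊕ Fin m → ℝ) × (Fin m → ℝ) =>
      eval (Sum.elim (p.1 ∘ Sum.inl) p.2) q := by
  refine (continuous_eval q).comp (continuous_pi fun k => ?_)
  rcases k with i | i <;> simp <;> fun_prop

/-- The sublevel sets of the optimal value function are closed. -/
lemma isClosed_setOf_optimalValue_le (hM : 0 < M)
    (hbox : ∀ z : Fin n ⊕ Fin m → ℝ, (∀ j, 0 ≤ eval z (h j)) → ∀ i, z i ^ 2 ≤ M)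
    (hJ : ∀ z : Fin n ⊕ Fin m → ℝ, (∀ i, z i ^ 2 ≤ M) → IsLeast
      ((fun v => eval (Sum.elim (z ∘ Sum.inl) (Sum.elim (z ∘ Sum.inr) v)) φ) ''
        {v | ∀ j, 0 ≤ eval (Sum.elim (z ∘ Sum.inl) v) (h j)}) (J z)) (c : ℝ) :
    IsClosed {z | (∀ i, z i ^ 2 ≤ M) ∧ J z ≤ c} := by
  have hcomp : IsCompact ({z : Fin n ⊕ Fin m → ℝ | ∀ i, z i ^ 2 ≤ M} ×ˢ
      {v : Fin m → ℝ | ∀ i, v i ^ 2 ≤ M}) :=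
    (isCompact_setOf_sq_le _ hM).prod (isCompact_setOf_sq_le _ hM)
  have hcl₁ : IsClosed {p : (Fin n ⊕ Fin m → ℝ) × (Fin m → ℝ) |
      ∀ j, 0 ≤ eval (Sum.elim (p.1 ∘ Sum.inl) p.2) (h j)} := by
    rw [ofPred_forall]
    exact isClosed_iInter fun j => isClosed_le continuous_const (continuous_eval_sumElim (h j))
  have hcl : IsClosed {p : (Fin n ⊕ Fin m → ℝ) × (Fin m → ℝ) |
      (∀ j, 0 ≤ eval (Sum.elim (p.1 ∘ Sum.inl) p.2) (h j)) ∧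
        eval (Sum.elim (p.1 ∘ Sum.inl) (Sum.elim (p.1 ∘ Sum.inr) p.2)) φ ≤ c} := hcl₁.inter (isClosed_le (continuous_eval_sumElim₂ φ) continuous_const)
  convert ((hcomp.inter_right hcl).image continuous_fst).isClosed using 1
  ext z
  constructor
  · rintro ⟨hz, hzc⟩
    obtain ⟨v, hv, hvJ⟩ := (hJ z hz).1
    exact ⟨(z, v), ⟨⟨hz, fun i => hbox _ hv (.inr i)⟩, hv, hvJ.trans_le hzc⟩, rfl⟩
  · rintro ⟨⟨z', v⟩, ⟨⟨hz, -⟩, hv, hvc⟩, rfl⟩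
    exact ⟨hz, ((hJ z' hz).2 ⟨v, hv, rfl⟩).trans hvc⟩

lemma integrableOn_optimalValue (hM : 0 < M)
    (hbox : ∀ z : Fin n ⊕ Fin m → ℝ, (∀ j, 0 ≤ eval z (h j)) → ∀ i, z i ^ 2 ≤ M)
    (hJ : ∀ z : Fin n ⊕ Fin m → ℝ, (∀ i, z i ^ 2 ≤ M) → IsLeast
      ((fun v => eval (Sum.elim (z ∘ Sum.inl) (Sum.elim (z ∘ Sum.inr) v)) φ) ''
        {v | ∀ j, 0 ≤ eval (Sum.elim (z ∘ Sum.inl) v) (h j)}) (J z)) :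
    IntegrableOn J {z | ∀ i, z i ^ 2 ≤ M} := by
  have hΩ := isCompact_setOf_sq_le (Fin n ⊕ Fin m) hM
  obtain ⟨C, hC⟩ := (hΩ.prod (isCompact_setOf_sq_le (Fin m) hM)).exists_bound_of_continuousOn
    (continuous_eval_sumElim₂ φ).continuousOn
  have hmeas : AEMeasurable J (volume.restrict {z : Fin n ⊕ Fin m → ℝ | ∀ i, z i ^ 2 ≤ M}) := by
    refine aemeasurable_restrict_of_measurable_subtype hΩ.measurableSet
      (measurable_of_Iic fun c => ?_)
    convert measurable_subtype_coe (isClosed_setOf_optimalValue_le hM hbox hJ c).measurableSet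
      using 1
    ext ⟨z, hz⟩
    exact ⟨fun h => ⟨hz, h⟩, fun h => h.2⟩
  refine IntegrableOn.of_bound hΩ.measure_lt_top hmeas.aestronglyMeasurable C ?_
  filter_upwards [ae_restrict_mem hΩ.measurableSet] with z hz
  obtain ⟨v, hv, hvJ⟩ := (hJ z hz).1
  rw [← hvJ]
  exact hC (z, v) ⟨hz, fun i => hbox _ hv (.inr i)⟩

end OptimalValue

/-- Feasibility for the relaxed problem, expressed without the optimal value function, is
semialgebraic in the relaxation parameter and the variables. -/
lemma signDefinable_feasible {n m r s : ℕ} (g : Fin r → MvPolynomial (Fin n ⊕ Fin m) ℝ)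
    (h : Fin s → MvPolynomial (Fin n ⊕ Fin m) ℝ)
    (φ : MvPolynomial (Fin n ⊕ (Fin m ⊕ Fin m)) ℝ) (M : ℝ) :
    SignDefinable fun y : Unit ⊕ (Fin n ⊕ Fin m) → ℝ =>
      (∀ i, y (.inr i) ^ 2 ≤ M) ∧ (∀ i, -y (.inl ()) ≤ eval (y ∘ Sum.inr) (g i)) ∧
        (∀ j, -y (.inl ()) ≤ eval (y ∘ Sum.inr) (h j)) ∧
        ∀ v : Fin m → ℝ, (∀ j, 0 ≤ eval (Sum.elim ((y ∘ Sum.inr) ∘ Sum.inl) v) (h j)) →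
          -y (.inl ()) ≤
            eval (Sum.elim ((y ∘ Sum.inr) ∘ Sum.inl) (Sum.elim ((y ∘ Sum.inr) ∘ Sum.inr) v)) φ := by
  refine .and (.forall_finite fun i => .le ((IsPolynomialFun.coord _).pow 2) (.const M)) <|
    .and (.forall_finite fun i => .le (IsPolynomialFun.coord _).neg
      (.eval_comp (fun _ => .coord _) _)) <|
    .and (.forall_finite fun j => .le (IsPolynomialFun.coord _).neg
      (.eval_comp (fun _ => .coord _) _)) ?_
  refine SignDefinable.forall_vector (S := fun (y : Unit ⊕ (Fin n ⊕ Fin m) → ℝ) (v : Fin m → ℝ) =>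
    (∀ j, 0 ≤ eval (Sum.elim ((y ∘ Sum.inr) ∘ Sum.inl) v) (h j)) → -y (.inl ()) ≤
      eval (Sum.elim ((y ∘ Sum.inr) ∘ Sum.inl) (Sum.elim ((y ∘ Sum.inr) ∘ Sum.inr) v)) φ) ?_
  refine .imp (.forall_finite fun j => .le (.const 0) (.eval_comp ?_ _))
    (.le (IsPolynomialFun.coord _).neg (.eval_comp ?_ _))
  · rintro (i | i) <;> exact .coord _
  · rintro (i | i | i) <;> exact .coord _

/-- (Lemma 4(ii).) Under assumption (H1) with `Ω` a box, if the
feasible set of (MPEC) is nonempty and `(J_k)` is a sequence of polynomials with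
`J_k ≤ J` on `Ω` and `J_k → J` in `L¹(Ω,μ)`, then for every `ε > 0` the limit
`lim_{k→∞} v_ε^k` exists and `val(P_ε) ≤ lim_k v_ε^k ≤ lim_{δ→ε⁻} val(P_δ)`; moreover
`val(P_ε) = lim_k v_ε^k` for all `ε ∈ (0,∞)` except finitely many points. Values are
taken in `EReal` (so `inf ∅ = +∞`), and `v_ε^k := min_{1 ≤ i ≤ k} val(P_ε^i)`. -/
theorem statement_13 (n m r s : ℕ)
    (f : MvPolynomial (Fin n ⊕ Fin m) ℝ)
    (g : Fin r → MvPolynomial (Fin n ⊕ Fin m) ℝ)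
    (h : Fin s → MvPolynomial (Fin n ⊕ Fin m) ℝ)
    (φ : MvPolynomial (Fin n ⊕ (Fin m ⊕ Fin m)) ℝ)
    (A B : Set (Fin n ⊕ Fin m → ℝ))
    (hA : A = {z | ∀ i, 0 ≤ eval z (g i)})
    (hB : B = {z | ∀ j, 0 ≤ eval z (h j)})
    (Bx : (Fin n → ℝ) → Set (Fin m → ℝ))
    (hBx : ∀ x, Bx x = {v | ∀ j, 0 ≤ eval (Sum.elim x v) (h j)})
    -- Ω is the box {z : z_i² ≤ M for all coordinates}, and it contains B
    (M : ℝ) (hM : 0 < M)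
    (Ω : Set (Fin n ⊕ Fin m → ℝ))
    (hΩ : Ω = {z | ∀ i, z i ^ 2 ≤ M})
    (hBΩ : B ⊆ Ω)
    -- assumption (H1)
    (hne : ∀ x ∈ (fun z : Fin n ⊕ Fin m → ℝ => z ∘ Sum.inl) '' Ω, (Bx x).Nonempty)
    -- the optimal value function J : the minimum is attained and equals J on Ω
    (J : (Fin n ⊕ Fin m → ℝ) → ℝ)
    (hJ : ∀ z ∈ Ω, IsLeast
      ((fun v => eval (Sum.elim (z ∘ Sum.inl) (Sum.elim (z ∘ Sum.inr) v)) φ) ''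
        Bx (z ∘ Sum.inl)) (J z))
    -- μ is the uniform probability measure on Ω
    (μ : Measure (Fin n ⊕ Fin m → ℝ))
    (hμ : μ = (volume Ω)⁻¹ • volume.restrict Ω)
    -- the feasible set of (MPEC) is nonempty
    (hFne : {z | z ∈ A ∩ B ∧ 0 ≤ J z}.Nonempty)
    -- the sequence (J_k): below J on Ω and converging to J in L¹(Ω,μ)
    (Jk : ℕ → MvPolynomial (Fin n ⊕ Fin m) ℝ)
    (hJkle : ∀ k, ∀ z ∈ Ω, eval z (Jk k) ≤ J z)
    (hJkconv : Tendsto (fun k => ∫ z, |eval z (Jk k) - J z| ∂μ) atTop (nhds 0))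
    -- val(P_ε): the value of the ε-approximation problem (in EReal)
    (valP : ℝ → EReal)
    (hvalP : ∀ ε : ℝ, valP ε = sInf ((fun z => ((eval z f : ℝ) : EReal)) ''
      {z ∈ Ω | (∀ i, -ε ≤ eval z (g i)) ∧ (∀ j, -ε ≤ eval z (h j)) ∧ -ε ≤ J z}))
    -- the sets S_k, the values val(P_ε^k) (in EReal, so inf ∅ = +∞) and v_ε^k
    (Sk : ℝ → ℕ → Set (Fin n ⊕ Fin m → ℝ))
    (hSk : ∀ ε k, Sk ε k = {z ∈ Ω | (∀ i, -ε ≤ eval z (g i)) ∧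
      (∀ j, -ε ≤ eval z (h j)) ∧ -ε ≤ eval z (Jk k)})
    (valPk : ℝ → ℕ → EReal)
    (hvalPk : ∀ ε k, valPk ε k = sInf ((fun z => ((eval z f : ℝ) : EReal)) '' Sk ε k))
    (v : ℝ → ℕ → EReal)
    (hv : ∀ ε k, v ε k = ⨅ i ∈ Finset.Icc 1 k, valPk ε i) :
    (∀ ε : ℝ, 0 < ε → ∃ L Lδ : EReal,
      Tendsto (fun k => v ε k) atTop (nhds L) ∧
      Tendsto valP (nhdsWithin ε (Set.Iio ε)) (nhds Lδ) ∧
      valP ε ≤ L ∧ L ≤ Lδ) ∧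
    ∃ T : Set ℝ, T.Finite ∧ ∀ ε : ℝ, 0 < ε → ε ∉ T →
      Tendsto (fun k => v ε k) atTop (nhds (valP ε)) := by
  subst hA hB hΩ
  obtain rfl : Bx = _ := funext hBx
  have hbox : ∀ z : Fin n ⊕ Fin m → ℝ, (∀ j, 0 ≤ eval z (h j)) → ∀ i, z i ^ 2 ≤ M :=
    fun z hz => hBΩ hz
  let Ω : Set (Fin n ⊕ Fin m → ℝ) := {z | ∀ i, z i ^ 2 ≤ M}
  have hΩc : IsCompact Ω := isCompact_setOf_sq_le _ hM
  have hvol : 0 < volume Ω := by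
    obtain ⟨z, ⟨-, hzB⟩, -⟩ := hFne
    have := volume_inter_setOf_sq_le_pos hM isOpen_univ ⟨z, mem_univ z, hbox z hzB⟩
    rwa [univ_inter] at this
  have hinv : (volume Ω)⁻¹ ≠ ⊤ := ENNReal.inv_ne_top.2 hvol.ne'
  have : IsFiniteMeasure (volume.restrict Ω) := ⟨by simpa using hΩc.measure_lt_top⟩
  have : IsFiniteMeasure μ := by
    rw [hμ]
    exact Measure.smul_finite _ hinv
  have hint : ∀ k, Integrable (fun z => eval z (Jk k) - J z) μ := fun k => by
    rw [hμ]
    exact Integrable.smul_measure (((continuous_eval _).continuousOn.integrableOn_compact hΩc).sub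
      (integrableOn_optimalValue hM hbox hJ)) hinv
  have key : ∀ δ ε : ℝ, δ < ε → ∀ z ∈ Ω, (∀ i, -δ ≤ eval z (g i)) → (∀ j, -δ ≤ eval z (h j)) →
      -δ ≤ J z → ∀ c, eval z f < c → ∃ k, 1 ≤ k ∧ ∃ w ∈ Sk ε k, eval w f < c := by
    intro δ ε hδ z hz hg hh hzJ c hc
    let U : Set (Fin n ⊕ Fin m → ℝ) := ((⋂ i, {w | -ε < eval w (g i)}) ∩
      (⋂ j, {w | -ε < eval w (h j)}) ∩ {w | eval w f < c}) ∩
      {w | (∀ i, w i ^ 2 ≤ M) ∧ J w ≤ -((δ + ε) / 2)}ᶜ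
    have hU : IsOpen U := by
      refine (((isOpen_iInter_of_finite fun i => ?_).inter (isOpen_iInter_of_finite fun j => ?_)).inter
        ?_).inter (isClosed_setOf_optimalValue_le hM hbox hJ _).isOpen_compl
      · exact isOpen_lt continuous_const (continuous_eval _)
      · exact isOpen_lt continuous_const (continuous_eval _)
      · exact isOpen_lt (continuous_eval _) continuous_const
    have hzU : z ∈ U := by
      refine ⟨⟨⟨mem_iInter.2 fun i => ?_, mem_iInter.2 fun j => ?_⟩, hc⟩, fun hle => ?_⟩
      · exact (neg_lt_neg hδ).trans_le (hg i)
      · exact (neg_lt_neg hδ).trans_le (hh j)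
      · linarith [hle.2]
    have hpos := volume_inter_setOf_sq_le_pos hM hU ⟨z, hzU, hz⟩
    have hμpos : μ (U ∩ Ω) ≠ 0 := by
      rw [hμ, Measure.smul_apply]
      change (volume Ω)⁻¹ • (volume.restrict Ω) (U ∩ Ω) ≠ 0
      rw [Measure.restrict_eq_self _ inter_subset_right]
      exact mul_ne_zero (ENNReal.inv_ne_zero.2 hΩc.measure_lt_top.ne) hpos.ne'
    obtain ⟨k, hk, w, ⟨⟨⟨⟨hwg, hwh⟩, hwf⟩, hwJ⟩, hwΩ⟩, hw⟩ :=
      exists_sub_lt_of_tendsto_integral_abs_sub hint hJkconv hμpos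
        (c := (ε - δ) / 2) (by linarith)
    have hwJ : -((δ + ε) / 2) < J w := not_le.1 fun hle => hwJ ⟨hwΩ, hle⟩
    refine ⟨k, hk, w, ?_, hwf⟩
    rw [hSk]
    exact ⟨hwΩ, fun i => (mem_iInter.1 hwg i).le, fun j => (mem_iInter.1 hwh j).le, by linarith⟩
  have hanti : Antitone valP := fun δ ε hδ => by
    rw [hvalP, hvalP]
    refine sInf_le_sInf (image_mono fun z hz => ?_)
    have hneg := neg_le_neg hδ
    exact ⟨hz.1, fun i => hneg.trans (hz.2.1 i), fun j => hneg.trans (hz.2.2.1 j),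
      hneg.trans hz.2.2.2⟩
  have hv_tendsto : ∀ ε, Tendsto (v ε) atTop (nhds (⨅ k, v ε k)) := fun ε =>
    tendsto_atTop_iInf fun i j hij => by
      rw [hv, hv]
      exact biInf_mono fun k hk => Finset.Icc_subset_Icc_right hij hk
  have hleft : ∀ ε, Tendsto valP (nhdsWithin ε (Iio ε)) (nhds (sInf (valP '' Iio ε))) :=
    fun ε => hanti.tendsto_nhdsLT ε
  have hlower : ∀ ε, valP ε ≤ ⨅ k, v ε k := fun ε => le_iInf fun k => by
    rw [hv]
    refine le_iInf₂ fun i _ => ?_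
    rw [hvalP, hvalPk, hSk]
    exact sInf_le_sInf (image_mono fun z hz =>
      ⟨hz.1, hz.2.1, hz.2.2.1, hz.2.2.2.trans (hJkle i z hz.1)⟩)
  have hupper : ∀ ε, ⨅ k, v ε k ≤ sInf (valP '' Iio ε) := fun ε => by
    refine le_sInf ?_
    rintro _ ⟨δ, hδ, rfl⟩
    rw [hvalP]
    refine le_sInf ?_
    rintro _ ⟨z, ⟨hz, hg, hh, hzJ⟩, rfl⟩
    by_contra! hlt
    obtain ⟨c, hzc, hc⟩ := EReal.lt_iff_exists_real_btwn.1 hlt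
    obtain ⟨k, hk, w, hw, hwc⟩ := key δ ε hδ z hz hg hh hzJ c (EReal.coe_lt_coe_iff.1 hzc)
    have hle : ⨅ k, v ε k ≤ (eval w f : ℝ) := by
      refine (iInf_le _ k).trans ?_
      rw [hv]
      refine (biInf_le _ (Finset.mem_Icc.2 ⟨hk, le_rfl⟩)).trans ?_
      rw [hvalPk]
      exact sInf_le ⟨w, hw, rfl⟩
    exact absurd (hc.trans_le hle) (not_lt.2 (EReal.coe_le_coe_iff.2 hwc.le))
  refine ⟨fun ε _ => ⟨_, _, hv_tendsto ε, hleft ε, hlower ε, hupper ε⟩, ?_⟩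
  let F : ℝ → (Fin n ⊕ Fin m → ℝ) → Prop := fun ε z =>
    (∀ i, z i ^ 2 ≤ M) ∧ (∀ i, -ε ≤ eval z (g i)) ∧ (∀ j, -ε ≤ eval z (h j)) ∧
      ∀ v : Fin m → ℝ, (∀ j, 0 ≤ eval (Sum.elim (z ∘ Sum.inl) v) (h j)) →
        -ε ≤ eval (Sum.elim (z ∘ Sum.inl) (Sum.elim (z ∘ Sum.inr) v)) φ
  have hF : ∀ ε z, F ε z ↔
      z ∈ Ω ∧ (∀ i, -ε ≤ eval z (g i)) ∧ (∀ j, -ε ≤ eval z (h j)) ∧ -ε ≤ J z := by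
    refine fun ε z => and_congr_right fun hz => and_congr_right fun _ => and_congr_right fun _ => ?_
    have hle := le_isGLB_iff (hJ z hz).isGLB (b := -ε)
    rw [hle]
    exact forall_mem_image.symm
  have hvalF : ∀ ε, valP ε = sInf ((fun z => ((eval z f : ℝ) : EReal)) '' {z | F ε z}) :=
    fun ε => by
      rw [hvalP]
      congr 2
      ext z
      exact (hF ε z).symm
  have hmem : ∀ ε z, F ε z → valP ε ≤ (eval z f : ℝ) := fun ε z hz => by
    rw [hvalF]
    exact sInf_le ⟨z, hz, rfl⟩
  let D : Set ℝ := {ε | ∃ c : ℝ, (∃ z, F ε z ∧ eval z f < c) ∧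
    ∀ δ < ε, ∀ z, F δ z → c ≤ eval z f}
  refine ⟨D, ?_, fun ε _ hε => ?_⟩
  · refine SignDefinable.finite_of_countable
      (SignDefinable.value_drop (F := F) (signDefinable_feasible g h φ M) f) ?_
    refine hanti.countable_not_continuousAt.mono ?_
    rintro ε ⟨c, ⟨z, hz, hzc⟩, hc⟩ hcont
    have heq := tendsto_nhds_unique (hleft ε) (hcont.tendsto.mono_left nhdsWithin_le_nhds)
    have hcle : (c : EReal) ≤ sInf (valP '' Iio ε) := by
      refine le_sInf ?_
      rintro _ ⟨δ, hδ, rfl⟩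
      rw [hvalF]
      refine le_sInf ?_
      rintro _ ⟨w, hw, rfl⟩
      exact EReal.coe_le_coe_iff.2 (hc δ hδ w hw)
    rw [heq] at hcle
    exact absurd (EReal.coe_le_coe_iff.1 (hcle.trans (hmem ε z hz))) (not_le.2 hzc)
  · suffices heq : valP ε = ⨅ k, v ε k by
      rw [heq]
      exact hv_tendsto ε
    refine (hlower ε).eq_of_not_lt fun hlt => hε ?_
    obtain ⟨c, hεc, hc⟩ := EReal.lt_iff_exists_real_btwn.1 hlt
    refine ⟨c, ?_, fun δ hδ z hz => ?_⟩
    · rw [hvalF, sInf_lt_iff] at hεc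
      obtain ⟨_, ⟨z, hz, rfl⟩, hzc⟩ := hεc
      exact ⟨z, hz, EReal.coe_lt_coe_iff.1 hzc⟩
    · exact EReal.coe_le_coe_iff.1
        (hc.le.trans ((hupper ε).trans ((sInf_le (mem_image_of_mem valP (mem_Iio.2 hδ))).trans (hmem δ z hz))))
end

section
/- Suppose assumption (H1) holds with Ω semi-algebraic, the feasible set {(x,y) ∈ A ∩ B : J(x,y) ≥ 0} of problem (MPEC) is nonempty, the function J : Ω → ℝ is continuous, and (J_k) is a sequence of polynomials with J_k(z) ≤ J(z) for all z ∈ Ω and J_k → J in L¹(Ω,μ). Then lim_{ε → 0⁺} lim_{k → ∞} v_ε^k = f_*, where f_* is the optimal value of problem (MPEC). -/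
open MvPolynomial Set Filter MeasureTheory

/-- On a compact set, a pointwise violated family of continuous constraints is uniformly
violated. -/
theorem IsCompact.exists_pos_forall_exists_lt_neg {X ι : Type*} [TopologicalSpace X]
    {K : Set X} (hK : IsCompact K) {c : ι → X → ℝ} (hc : ∀ i, ContinuousOn (c i) K)
    (hneg : ∀ z ∈ K, ∃ i, c i z < 0) :
    ∃ ε > 0, ∀ z ∈ K, ∃ i, c i z < -ε := by
  refine hK.induction_on (p := fun s => ∃ ε > 0, ∀ z ∈ s, ∃ i, c i z < -ε)
    ⟨1, one_pos, by simp⟩ ?_ ?_ ?_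
  · rintro s t hst ⟨ε, hε, ht⟩
    exact ⟨ε, hε, fun z hz => ht z (hst hz)⟩
  · rintro s t ⟨ε, hε, hs⟩ ⟨δ, hδ, ht⟩
    refine ⟨min ε δ, lt_min hε hδ, ?_⟩
    rintro z (hz | hz)
    · obtain ⟨i, hi⟩ := hs z hz
      exact ⟨i, by linarith [min_le_left ε δ]⟩
    · obtain ⟨i, hi⟩ := ht z hz
      exact ⟨i, by linarith [min_le_right ε δ]⟩
  · intro z hz
    obtain ⟨i, hi⟩ := hneg z hz
    refine ⟨{w | c i w < c i z / 2}, ?_, -(c i z / 2), by linarith,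
      fun w hw => ⟨i, by simpa using hw⟩⟩
    exact (hc i z hz).eventually (gt_mem_nhds (by linarith))

/-- Continuous functions whose `L¹` distance to `J` tends to `0` along `k` come within `δ` of `J`
somewhere on any set of positive measure. -/
theorem exists_abs_lt_of_tendsto_integral_abs {X : Type*} [MeasurableSpace X] {μ : Measure X}
    [IsFiniteMeasure μ] {F : ℕ → X → ℝ} (hF : ∀ k, Integrable (F k) μ)
    (hlim : Tendsto (fun k => ∫ z, |F k z| ∂μ) atTop (nhds 0)) {V : Set X} (hV : 0 < μ V)
    {δ : ℝ} (hδ : 0 < δ) : ∃ k, 1 ≤ k ∧ ∃ z ∈ V, |F k z| < δ := by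
  by_contra! hcon
  have hpos : 0 < δ * μ.real V := mul_pos hδ (ENNReal.toReal_pos hV.ne' (measure_ne_top _ _))
  refine hpos.not_ge (ge_of_tendsto hlim ?_)
  filter_upwards [eventually_ge_atTop 1] with k hk
  calc δ * μ.real V ≤ δ * μ.real {z | δ ≤ |F k z|} :=
        mul_le_mul_of_nonneg_left (measureReal_mono fun z hz => hcon k hk z hz) hδ.le
    _ ≤ _ := mul_meas_ge_le_integral_of_nonneg (.of_forall fun _ => abs_nonneg _) (hF k).abs δ

theorem setOf_forall_sq_le_eq_Icc {ι : Type*} {M : ℝ} (hM : 0 ≤ M) :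
    {z : ι → ℝ | ∀ i, z i ^ 2 ≤ M} = Icc (fun _ => -√M) (fun _ => √M) := by
  ext z
  simp only [mem_ofPred_eq, mem_Icc, Pi.le_def, ← forall_and]
  exact forall_congr' fun i => Real.sq_le hM

/-- A nonempty relatively open subset of a convex set with nonempty interior has positive
measure. -/
theorem Convex.measure_inter_pos {E : Type*} [NormedAddCommGroup E] [NormedSpace ℝ E]
    [MeasurableSpace E] {μ : Measure E} [μ.IsOpenPosMeasure] {K O : Set E} (hK : Convex ℝ K)
    (hint : (interior K).Nonempty) (hO : IsOpen O) (hne : (O ∩ K).Nonempty) :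
    0 < μ (O ∩ K) := by
  obtain ⟨z, hzO, hzK⟩ := hne
  have hz : z ∈ closure (interior K) := by
    rw [hK.closure_interior_eq_closure_of_nonempty_interior hint]
    exact subset_closure hzK
  have hne' := mem_closure_iff.1 hz O hO hzO
  exact ((hO.inter isOpen_interior).measure_pos μ hne').trans_le
    (measure_mono (inter_subset_inter_right _ interior_subset))

/-- Under assumption (H1) with `Ω` a (semi-algebraic) box, if the
feasible set of (MPEC) is nonempty, `J` is continuous on `Ω`, and `(J_k)` satisfies
`J_k ≤ J` on `Ω` together with `J_k → J` in `L¹(Ω,μ)`, then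
`lim_{ε→0⁺} lim_{k→∞} v_ε^k = f_*`, where `f_*` is the optimal value of (MPEC).
For each `ε > 0` the sequence `k ↦ v_ε^k` is non-increasing, so its limit is
`⨅ k, v_ε^k`; the conclusion asserts that `v_ε^k` indeed converges to this limit as
`k → ∞` and that this limit tends to `f_*` as `ε → 0⁺`. Values are in `EReal`
(so `inf ∅ = +∞`). -/
theorem statement_15 (n m r s : ℕ)
    (f : MvPolynomial (Fin n ⊕ Fin m) ℝ)
    (g : Fin r → MvPolynomial (Fin n ⊕ Fin m) ℝ)
    (h : Fin s → MvPolynomial (Fin n ⊕ Fin m) ℝ)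
    (φ : MvPolynomial (Fin n ⊕ (Fin m ⊕ Fin m)) ℝ)
    (A B : Set (Fin n ⊕ Fin m → ℝ))
    (hA : A = {z | ∀ i, 0 ≤ eval z (g i)})
    (hB : B = {z | ∀ j, 0 ≤ eval z (h j)})
    (Bx : (Fin n → ℝ) → Set (Fin m → ℝ))
    (hBx : ∀ x, Bx x = {v | ∀ j, 0 ≤ eval (Sum.elim x v) (h j)})
    -- Ω is the box {z : z_i² ≤ M for all coordinates}, and it contains B
    (M : ℝ) (hM : 0 < M)
    (Ω : Set (Fin n ⊕ Fin m → ℝ))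
    (hΩ : Ω = {z | ∀ i, z i ^ 2 ≤ M})
    (hBΩ : B ⊆ Ω)
    -- assumption (H1)
    (hne : ∀ x ∈ (fun z : Fin n ⊕ Fin m → ℝ => z ∘ Sum.inl) '' Ω, (Bx x).Nonempty)
    -- the optimal value function J : the minimum is attained and equals J on Ω
    (J : (Fin n ⊕ Fin m → ℝ) → ℝ)
    (hJ : ∀ z ∈ Ω, IsLeast
      ((fun v => eval (Sum.elim (z ∘ Sum.inl) (Sum.elim (z ∘ Sum.inr) v)) φ) ''
        Bx (z ∘ Sum.inl)) (J z))
    -- J is continuous on Ω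
    (hJcont : ContinuousOn J Ω)
    -- μ is the uniform probability measure on Ω
    (μ : Measure (Fin n ⊕ Fin m → ℝ))
    (hμ : μ = (volume Ω)⁻¹ • volume.restrict Ω)
    -- the feasible set of (MPEC) is nonempty, and f_* is its optimal value
    (Feas : Set (Fin n ⊕ Fin m → ℝ))
    (hFeas : Feas = {z | z ∈ A ∩ B ∧ 0 ≤ J z})
    (hFne : Feas.Nonempty)
    (fstar : ℝ)
    (hfstar : fstar = sInf ((fun z => eval z f) '' Feas))
    -- the sequence (J_k): below J on Ω and converging to J in L¹(Ω,μ)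
    (Jk : ℕ → MvPolynomial (Fin n ⊕ Fin m) ℝ)
    (hJkle : ∀ k, ∀ z ∈ Ω, eval z (Jk k) ≤ J z)
    (hJkconv : Tendsto (fun k => ∫ z, |eval z (Jk k) - J z| ∂μ) atTop (nhds 0))
    -- the sets S_k, the values val(P_ε^k) (in EReal, so inf ∅ = +∞) and v_ε^k
    (Sk : ℝ → ℕ → Set (Fin n ⊕ Fin m → ℝ))
    (hSk : ∀ ε k, Sk ε k = {z ∈ Ω | (∀ i, -ε ≤ eval z (g i)) ∧
      (∀ j, -ε ≤ eval z (h j)) ∧ -ε ≤ eval z (Jk k)})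
    (valPk : ℝ → ℕ → EReal)
    (hvalPk : ∀ ε k, valPk ε k = sInf ((fun z => ((eval z f : ℝ) : EReal)) '' Sk ε k))
    (v : ℝ → ℕ → EReal)
    (hv : ∀ ε k, v ε k = ⨅ i ∈ Finset.Icc 1 k, valPk ε i) :
    -- for each ε > 0, v_ε^k converges as k → ∞ (to its infimum), and
    -- lim_{ε→0⁺} lim_{k→∞} v_ε^k = f_*
    (∀ ε : ℝ, 0 < ε → Tendsto (fun k => v ε k) atTop (nhds (⨅ k, v ε k))) ∧
    Tendsto (fun ε : ℝ => ⨅ k, v ε k) (nhdsWithin 0 (Set.Ioi 0))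
      (nhds ((fstar : ℝ) : EReal)) := by
  have hΩIcc := hΩ.trans (setOf_forall_sq_le_eq_Icc hM.le)
  have hΩc : IsCompact Ω := hΩIcc ▸ isCompact_Icc
  have hΩconv : Convex ℝ Ω := hΩIcc ▸ convex_Icc _ _
  have hΩint : (interior Ω).Nonempty := by
    refine ⟨0, mem_interior.2 ⟨{z | ∀ i, z i ^ 2 < M}, ?_, ?_, fun i => by simpa using hM⟩⟩
    · rw [hΩ]
      exact fun z hz i => (hz i).le
    · simp only [ofPred_forall]
      exact isOpen_iInter_of_finite fun i => isOpen_lt (by fun_prop) continuous_const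
  have hΩpos : volume Ω ≠ 0 :=
    ((isOpen_interior.measure_pos volume hΩint).trans_le (measure_mono interior_subset)).ne'
  have hΩtop : volume Ω ≠ ⊤ := hΩc.measure_lt_top.ne
  have hμfin : IsFiniteMeasure μ := by
    have : IsFiniteMeasure (volume.restrict Ω) := ⟨by simpa using hΩtop.lt_top⟩
    rw [hμ]
    exact Measure.smul_finite _ (ENNReal.inv_ne_top.2 hΩpos)
  have hpc (p : MvPolynomial (Fin n ⊕ Fin m) ℝ) : Continuous fun z => eval z p :=
    MvPolynomial.continuous_eval p
  have hFΩ : Feas ⊆ Ω := by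
    rw [hFeas]
    exact fun z hz => hBΩ hz.1.2
  have hbdd : BddBelow ((fun z => eval z f) '' Feas) :=
    (hΩc.bddBelow_image (hpc f).continuousOn).mono (image_mono hFΩ)
  have hanti (ε : ℝ) : Antitone (v ε) := by
    intro a b hab
    simp only [hv]
    exact biInf_mono fun i hi => Finset.Icc_subset_Icc_right hab hi
  have hupper (ε : ℝ) (hε : 0 < ε) (c : ℝ) (hc : fstar < c) : ⨅ k, v ε k < (c : EReal) := by
    obtain ⟨_, ⟨z₀, hz₀, rfl⟩, hz₀c⟩ :=
      exists_lt_of_csInf_lt (hFne.image fun z => eval z f) (hfstar ▸ hc)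
    have hz₀Ω := hFΩ hz₀
    rw [hFeas, hA, hB] at hz₀
    obtain ⟨⟨hgz, hhz⟩, hJz⟩ := hz₀
    obtain ⟨O, hO, hOJ⟩ := continuousOn_iff'.1 hJcont (Ioi (-(ε / 2))) isOpen_Ioi
    let W : Set (Fin n ⊕ Fin m → ℝ) :=
      {z | eval z f < c ∧ (∀ i, -ε < eval z (g i)) ∧ ∀ j, -ε < eval z (h j)}
    have hopen {l : ℕ} (p : Fin l → MvPolynomial (Fin n ⊕ Fin m) ℝ) :
        IsOpen {z | ∀ i, -ε < eval z (p i)} := by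
      simp only [ofPred_forall]
      exact isOpen_iInter_of_finite fun i => isOpen_lt continuous_const (hpc _)
    have hW : IsOpen W :=
      (isOpen_lt (hpc f) continuous_const).inter ((hopen g).inter (hopen h))
    have hz₀O : z₀ ∈ O ∩ Ω := hOJ ▸ ⟨show -(ε / 2) < J z₀ by linarith, hz₀Ω⟩
    have hpos : 0 < volume ((W ∩ O) ∩ Ω) :=
      hΩconv.measure_inter_pos hΩint (hW.inter hO)
        ⟨z₀, ⟨⟨hz₀c, fun i => (neg_lt_zero.2 hε).trans_le (hgz i),
          fun j => (neg_lt_zero.2 hε).trans_le (hhz j)⟩, hz₀O.1⟩, hz₀Ω⟩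
    have hμpos : 0 < μ ((W ∩ O) ∩ Ω) := by
      rw [hμ, Measure.smul_apply, Measure.restrict_apply' hΩc.measurableSet, inter_assoc,
        inter_self, smul_eq_mul]
      exact ENNReal.mul_pos (ENNReal.inv_ne_zero.2 hΩtop) hpos.ne'
    have hint (k : ℕ) : Integrable (fun z => eval z (Jk k) - J z) μ := by
      rw [hμ]
      exact (((hpc _).continuousOn.sub hJcont).integrableOn_compact hΩc).integrable.smul_measure
        (ENNReal.inv_ne_top.2 hΩpos)
    obtain ⟨k, hk, z, ⟨⟨⟨hzf, hzg, hzh⟩, hzO⟩, hzΩ⟩, hzJ⟩ :=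
      exists_abs_lt_of_tendsto_integral_abs hint hJkconv hμpos (half_pos hε)
    have hJz' : -(ε / 2) < J z := by
      have : z ∈ J ⁻¹' Ioi (-(ε / 2)) ∩ Ω := hOJ ▸ ⟨hzO, hzΩ⟩
      exact this.1
    have hzS : z ∈ Sk ε k := by
      rw [hSk]
      exact ⟨hzΩ, fun i => (hzg i).le, fun j => (hzh j).le, by linarith [(abs_lt.1 hzJ).1]⟩
    calc ⨅ k, v ε k ≤ v ε k := iInf_le _ k
      _ ≤ valPk ε k := by
          rw [hv]
          exact biInf_le _ (Finset.mem_Icc.2 ⟨hk, le_rfl⟩)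
      _ ≤ ((eval z f : ℝ) : EReal) := by
          rw [hvalPk]
          exact sInf_le ⟨z, hzS, rfl⟩
      _ < c := EReal.coe_lt_coe_iff.2 hzf
  have hlower (c : ℝ) (hc : c < fstar) :
      ∃ ε₀ > 0, ∀ ε ≤ ε₀, (c : EReal) ≤ ⨅ k, v ε k := by
    have hK : IsCompact (Ω ∩ {z | eval z f ≤ c}) :=
      hΩc.inter_right (isClosed_le (hpc f) continuous_const)
    let q : Option (Fin r ⊕ Fin s) → (Fin n ⊕ Fin m → ℝ) → ℝ := fun o z =>
      o.elim (J z) (Sum.elim (fun i => eval z (g i)) (fun j => eval z (h j)))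
    have hq : ∀ o, ContinuousOn (q o) (Ω ∩ {z | eval z f ≤ c}) := by
      rintro (_ | i | j)
      · exact hJcont.mono inter_subset_left
      · exact (hpc (g i)).continuousOn
      · exact (hpc (h j)).continuousOn
    obtain ⟨ε₀, hε₀, hviol⟩ := hK.exists_pos_forall_exists_lt_neg hq (by
      rintro z ⟨-, hzf⟩
      by_contra! hcon
      have hzF : z ∈ Feas := by
        rw [hFeas, hA, hB]
        exact ⟨⟨fun i => hcon (some (.inl i)), fun j => hcon (some (.inr j))⟩, hcon none⟩
      have hle : fstar ≤ eval z f := hfstar ▸ csInf_le hbdd ⟨z, hzF, rfl⟩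
      exact absurd (hle.trans hzf) hc.not_ge)
    refine ⟨ε₀, hε₀, fun ε hε => le_iInf fun k => ?_⟩
    rw [hv]
    refine le_iInf₂ fun i _ => ?_
    rw [hvalPk]
    refine le_sInf ?_
    rintro _ ⟨z, hz, rfl⟩
    rw [hSk] at hz
    obtain ⟨hzΩ, hzg, hzh, hzJ⟩ := hz
    refine EReal.coe_le_coe_iff.2 (le_of_not_gt fun hlt => ?_)
    obtain ⟨_ | a | b, ho⟩ := hviol z ⟨hzΩ, hlt.le⟩
    · have : J z < -ε₀ := ho
      linarith [hJkle i z hzΩ]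
    · have : eval z (g a) < -ε₀ := ho
      linarith [hzg a]
    · have : eval z (h b) < -ε₀ := ho
      linarith [hzh b]
  refine ⟨fun ε _ => tendsto_atTop_iInf (hanti ε), tendsto_order.2 ⟨fun a ha => ?_, fun b hb => ?_⟩⟩
  · obtain ⟨c, hac, hc⟩ := EReal.lt_iff_exists_real_btwn.1 ha
    obtain ⟨ε₀, hε₀, hε₀'⟩ := hlower c (EReal.coe_lt_coe_iff.1 hc)
    filter_upwards [Ioc_mem_nhdsGT hε₀] with ε hε
    exact hac.trans_le (hε₀' ε hε.2)
  · obtain ⟨c, hc, hcb⟩ := EReal.lt_iff_exists_real_btwn.1 hb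
    filter_upwards [self_mem_nhdsWithin] with ε hε
    exact (hupper ε hε c (EReal.coe_lt_coe_iff.1 hc)).trans hcb
end
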